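/- arXiv:0806.3463 — 6 statements merged into one kernel-verified Lean document; each statement's English description precedes it below -/
import Mathlib

section
/- For every integer i ≥ 1, the polynomial L_i(X) := ∏_{j=1}^{i} (X^{q^j} − X) in F_q[X] is the least common multiple of all monic polynomials of degree i in F_q[X]; that is, every monic polynomial of degree i over F_q divides L_i(X), and any polynomial in F_q[X] that is divisible by every monic polynomial of degree i is divisible by L_i(X). -/
open Polynomial

section

variable {F : Type*} [Field F]

theorem separable_X_pow_card_pow_sub_X [Fintype F] {j : ℕ} (hj : j ≠ 0) :
    (X ^ Fintype.card F ^ j - X : F[X]).Separable := by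
  obtain ⟨p, hp⟩ := CharP.exists F
  exact galois_poly_separable p _ (dvd_pow ((CharP.cast_eq_zero_iff F p _).1
    (FiniteField.cast_card_eq_zero F)) hj)

theorem emultiplicity_X_pow_card_pow_sub_X [Fintype F] {P : F[X]} (hP : Irreducible P) {j : ℕ}
    (hj : j ≠ 0) :
    emultiplicity P (X ^ Fintype.card F ^ j - X) = if P.natDegree ∣ j then 1 else 0 := by
  have h := hP.natDegree_dvd_iff_dvd_X_pow_card_pow_sub_X (n := j)
  rw [Nat.card_eq_fintype_card] at h
  split_ifs with hd
  · exact le_antisymm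
      (emultiplicity_le_one_of_separable hP.not_isUnit (separable_X_pow_card_pow_sub_X hj))
      (Order.one_le_iff_pos.2 (dvd_iff_emultiplicity_pos.2 (h.1 hd)))
  · exact emultiplicity_eq_zero.2 fun hdvd ↦ hd (h.2 hdvd)

theorem emultiplicity_prod_X_pow_card_pow_sub_X [Fintype F] {P : F[X]} (hP : Irreducible P)
    (i : ℕ) :
    emultiplicity P (∏ j ∈ Finset.Icc 1 i, (X ^ Fintype.card F ^ j - X)) =
      (i / P.natDegree : ℕ) := by
  rw [Finset.emultiplicity_prod hP.prime, Finset.sum_congr rfl fun j hj ↦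
      emultiplicity_X_pow_card_pow_sub_X hP (Nat.one_le_iff_ne_zero.1 (Finset.mem_Icc.1 hj).1),
    Finset.sum_boole, ← Nat.Ioc_filter_dvd_card_eq_div]
  rfl

theorem emultiplicity_le_natDegree_div {P f : F[X]} (hP : Irreducible P) (hf : f ≠ 0) :
    emultiplicity P f ≤ (f.natDegree / P.natDegree : ℕ) := by
  rw [(FiniteMultiplicity.of_prime_left hP.prime hf).emultiplicity_eq_multiplicity, Nat.cast_le,
    Nat.le_div_iff_mul_le hP.natDegree_pos, ← natDegree_pow]
  exact natDegree_le_of_dvd (pow_multiplicity_dvd P f) hf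

theorem exists_monic_natDegree_eq_pow_dvd {P : F[X]} (hP : P ≠ 0) {i n : ℕ}
    (h : n * P.natDegree ≤ i) : ∃ f : F[X], f.Monic ∧ f.natDegree = i ∧ P ^ n ∣ f := by
  have hm : (P * C P.leadingCoeff⁻¹).Monic := monic_mul_leadingCoeff_inv hP
  refine ⟨(P * C P.leadingCoeff⁻¹) ^ n * X ^ (i - n * P.natDegree),
    (hm.pow n).mul (monic_X_pow _), ?_,
    (pow_dvd_pow_of_dvd (dvd_mul_right _ _) n).mul_right _⟩
  rw [(hm.pow n).natDegree_mul (monic_X_pow _), hm.natDegree_pow, natDegree_X_pow,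
    natDegree_mul_leadingCoeff_inv _ hP]
  omega

end

/-- For `i ≥ 1`, `L_i(X) = ∏_{j=1}^{i} (X^{q^j} − X)` in `F_q[X]` is the least
common multiple of all monic polynomials of degree `i`. -/
theorem carlitz_L_is_lcm_of_monics (p q : ℕ) (hp : p.Prime)
    (hq : ∃ n : ℕ, 0 < n ∧ q = p ^ n)
    (F : Type*) [Field F] [Fintype F] (hF : Fintype.card F = q)
    (i : ℕ) (hi : 1 ≤ i) :
    (∀ f : Polynomial F, f.Monic → f.natDegree = i →
        f ∣ ∏ j ∈ Finset.Icc 1 i, (X ^ q ^ j - X)) ∧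
    (∀ g : Polynomial F,
        (∀ f : Polynomial F, f.Monic → f.natDegree = i → f ∣ g) →
        (∏ j ∈ Finset.Icc 1 i, (X ^ q ^ j - X)) ∣ g) := by
  subst hF
  refine ⟨fun f hf hfi ↦ ?_, fun g hg ↦ ?_⟩
  · rw [UniqueFactorizationMonoid.dvd_iff_emultiplicity_le hf.ne_zero]
    intro P hP
    rw [emultiplicity_prod_X_pow_card_pow_sub_X hP.irreducible, ← hfi]
    exact emultiplicity_le_natDegree_div hP.irreducible hf.ne_zero
  · have h0 : ∏ j ∈ Finset.Icc 1 i, (X ^ Fintype.card F ^ j - X : F[X]) ≠ 0 :=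
      Finset.prod_ne_zero_iff.2 fun j hj ↦ (separable_X_pow_card_pow_sub_X
        (Nat.one_le_iff_ne_zero.1 (Finset.mem_Icc.1 hj).1)).ne_zero
    rw [UniqueFactorizationMonoid.dvd_iff_emultiplicity_le h0]
    intro P hP
    rw [emultiplicity_prod_X_pow_card_pow_sub_X hP.irreducible, ← pow_dvd_iff_le_emultiplicity]
    obtain ⟨f, hf, hfi, hdvd⟩ :=
      exists_monic_natDegree_eq_pow_dvd hP.ne_zero (Nat.div_mul_le_self i P.natDegree)
    exact hdvd.trans (hg f hf hfi)
end

section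
/- For every integer i ≥ 1, the polynomial D_i(X) := ∏_{j=1}^{i} (X^{q^j} − X)^{q^{i−j}} in F_q[X] equals the product of all monic polynomials of degree i in F_q[X]. -/
open Polynomial

namespace CarlitzD

variable (F : Type*) [Field F] [Fintype F]

/-- The Carlitz linear polynomials `e_i(z) = ∏_{deg a < i} (z + a)`, as functions on `F[X]`,
defined through their `q`-power recursion. -/
noncomputable def carlitzE : ℕ → F[X] → F[X]
  | 0, z => z
  | i + 1, z => carlitzE i z ^ Fintype.card F
      - carlitzE i (X ^ i) ^ (Fintype.card F - 1) * carlitzE i z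

variable {F}

lemma add_pow_card (a b : F[X]) :
    (a + b) ^ Fintype.card F = a ^ Fintype.card F + b ^ Fintype.card F :=
  map_add (FiniteField.frobeniusAlgHom F F[X]) a b

lemma sub_pow_card (a b : F[X]) :
    (a - b) ^ Fintype.card F = a ^ Fintype.card F - b ^ Fintype.card F :=
  map_sub (FiniteField.frobeniusAlgHom F F[X]) a b

lemma carlitzE_add (i : ℕ) (z w : F[X]) :
    carlitzE F i (z + w) = carlitzE F i z + carlitzE F i w := by
  induction i with
  | zero => rfl
  | succ i ih => simp only [carlitzE, ih, add_pow_card]; ring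

lemma carlitzE_C_mul (i : ℕ) (c : F) (z : F[X]) :
    carlitzE F i (C c * z) = C c * carlitzE F i z := by
  induction i with
  | zero => rfl
  | succ i ih =>
    simp only [carlitzE, ih, mul_pow, ← C_pow, FiniteField.pow_card]; ring

lemma carlitzE_succ_X_pow (i : ℕ) : carlitzE F (i + 1) (X ^ i) = 0 := by
  simp [carlitzE, pow_sub_one_mul]

lemma carlitzE_succ_X_mul (i : ℕ) (z : F[X]) :
    carlitzE F (i + 1) (X * z) = X * carlitzE F (i + 1) z
      + (X ^ Fintype.card F ^ (i + 1) - X) * carlitzE F i z ^ Fintype.card F := by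
  induction i generalizing z with
  | zero => simp [carlitzE]; ring
  | succ i ih =>
    have hD : carlitzE F (i + 1) (X ^ (i + 1))
        = (X ^ Fintype.card F ^ (i + 1) - X) * carlitzE F i (X ^ i) ^ Fintype.card F := by
      rw [pow_succ' X i, ih, carlitzE_succ_X_pow, mul_zero, zero_add]
    have hz : carlitzE F (i + 1) z ^ Fintype.card F
        = (carlitzE F i z ^ Fintype.card F) ^ Fintype.card F
          - (carlitzE F i (X ^ i) ^ Fintype.card F) ^ (Fintype.card F - 1)
            * carlitzE F i z ^ Fintype.card F := by
      rw [carlitzE, sub_pow_card, mul_pow, pow_right_comm _ (_ - 1)]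
    have hbr : (X ^ Fintype.card F ^ (i + 2) - X : F[X])
        = (X ^ Fintype.card F ^ (i + 1) - X) ^ Fintype.card F + (X ^ Fintype.card F - X) := by
      rw [sub_pow_card, ← pow_mul, ← pow_succ]; ring
    have hpow : (X ^ Fintype.card F ^ (i + 1) - X : F[X]) ^ (Fintype.card F - 1)
        * (X ^ Fintype.card F ^ (i + 1) - X)
        = (X ^ Fintype.card F ^ (i + 1) - X) ^ Fintype.card F :=
      pow_sub_one_mul Fintype.card_ne_zero _
    have hD' : carlitzE F (i + 1) (X ^ (i + 1)) ^ (Fintype.card F - 1)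
        * (X ^ Fintype.card F ^ (i + 1) - X)
        = (X ^ Fintype.card F ^ (i + 1) - X) ^ Fintype.card F
          * (carlitzE F i (X ^ i) ^ Fintype.card F) ^ (Fintype.card F - 1) := by
      rw [hD, mul_pow, ← hpow]; ring
    have hrec (w : F[X]) : carlitzE F (i + 2) w = carlitzE F (i + 1) w ^ Fintype.card F
        - carlitzE F (i + 1) (X ^ (i + 1)) ^ (Fintype.card F - 1) * carlitzE F (i + 1) w := rfl
    rw [hrec, hrec, ih, add_pow_card, mul_pow, mul_pow, hbr]
    linear_combination (-carlitzE F i z ^ Fintype.card F) * hD'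
      - (X ^ Fintype.card F ^ (i + 1) - X) ^ Fintype.card F * hz

lemma carlitzE_X_pow (i : ℕ) :
    carlitzE F i (X ^ i)
      = ∏ j ∈ Finset.Icc 1 i, (X ^ Fintype.card F ^ j - X) ^ Fintype.card F ^ (i - j) := by
  induction i with
  | zero => simp [carlitzE]
  | succ i ih =>
    rw [pow_succ', carlitzE_succ_X_mul, carlitzE_succ_X_pow, mul_zero, zero_add, ih,
      Finset.prod_Icc_succ_top (by lia), Nat.sub_self, pow_zero, pow_one, mul_comm,
      ← Finset.prod_pow]
    congr 1
    refine Finset.prod_congr rfl fun j hj => ?_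
    rw [← pow_mul, ← pow_succ, Nat.succ_sub (Finset.mem_Icc.mp hj).2]

lemma prod_add_algebraMap_mul {K : Type*} [Field K] [Algebra F K] (y d : K) :
    ∏ c : F, (y + algebraMap F K c * d)
      = y ^ Fintype.card F - d ^ (Fintype.card F - 1) * y := by
  have hq := Fintype.one_lt_card (α := F)
  rcases eq_or_ne d 0 with rfl | hd
  · simp [zero_pow (Nat.sub_ne_zero_of_lt hq)]
  have hmonic : (X ^ Fintype.card F - X : F[X]).Monic := monic_X_pow_sub (by simpa using hq)
  have hprod : ∏ c : F, (X - C c) = X ^ Fintype.card F - X := by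
    have := prod_multiset_X_sub_C_of_monic_of_roots_card_eq hmonic (by
      rw [FiniteField.roots_X_pow_card_sub_X, FiniteField.X_pow_card_sub_X_natDegree_eq _ hq]; rfl)
    rwa [FiniteField.roots_X_pow_card_sub_X] at this
  have h := congrArg (aeval (y / d)) hprod
  simp only [map_prod, map_sub, aeval_X, aeval_C, map_pow] at h
  calc ∏ c : F, (y + algebraMap F K c * d)
      = ∏ c : F, (y / d - algebraMap F K c) * d := by
        rw [← Equiv.prod_comp (Equiv.neg F)]
        refine Finset.prod_congr rfl fun c _ => ?_
        rw [sub_mul, div_mul_cancel₀ _ hd, Equiv.neg_apply, map_neg]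
        ring
    _ = ((y / d) ^ Fintype.card F - y / d) * d ^ Fintype.card F := by
        rw [Finset.prod_mul_distrib, h, Finset.prod_const, Finset.card_univ]
    _ = y ^ Fintype.card F - d ^ (Fintype.card F - 1) * y := by
        rw [sub_mul, ← mul_pow, div_mul_cancel₀ _ hd, ← pow_sub_one_mul Fintype.card_ne_zero d]
        field_simp

lemma prod_add_C_mul (y d : F[X]) :
    ∏ c : F, (y + C c * d) = y ^ Fintype.card F - d ^ (Fintype.card F - 1) * y := by
  apply IsFractionRing.injective F[X] (RatFunc F)
  have := prod_add_algebraMap_mul (F := F) (algebraMap F[X] (RatFunc F) y) (algebraMap _ _ d)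
  simpa [map_prod, IsScalarTower.algebraMap_apply F F[X] (RatFunc F)] using this

lemma carlitzE_eq_prod (i : ℕ) (z : F[X]) :
    carlitzE F i z = ∏ a : Fin i → F, (z + ∑ j, C (a j) * X ^ (j : ℕ)) := by
  induction i generalizing z with
  | zero => simp [carlitzE]
  | succ i ih =>
    rw [carlitzE, ← prod_add_C_mul, ← (Fin.snocEquiv fun _ => F).prod_comp,
      Fintype.prod_prod_type]
    refine Finset.prod_congr rfl fun c _ => ?_
    rw [← carlitzE_C_mul, ← carlitzE_add, ih]
    refine Finset.prod_congr rfl fun a _ => ?_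
    simp [Fin.sum_univ_castSucc, Fin.snocEquiv]
    ring

end CarlitzD

/-- For `i ≥ 1`, `D_i(X) = ∏_{j=1}^{i} (X^{q^j} − X)^{q^{i−j}}` equals the
product of all monic polynomials of degree `i` in `F_q[X]`. -/
theorem carlitz_D_eq_prod_of_monics (p q : ℕ) (hp : p.Prime)
    (hq : ∃ n : ℕ, 0 < n ∧ q = p ^ n)
    (F : Type*) [Field F] [Fintype F] (hF : Fintype.card F = q)
    (i : ℕ) (hi : 1 ≤ i)
    (S : Finset (Polynomial F))
    (hS : ∀ f : Polynomial F, f ∈ S ↔ f.Monic ∧ f.natDegree = i) :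
    ∏ j ∈ Finset.Icc 1 i, (X ^ q ^ j - X) ^ q ^ (i - j) = ∏ f ∈ S, f := by
  subst hF
  rw [← CarlitzD.carlitzE_X_pow, CarlitzD.carlitzE_eq_prod]
  have hdeg (a : Fin i → F) : (∑ j, C (a j) * X ^ (j : ℕ)).degree < (i : WithBot ℕ) :=
    degree_sum_fin_lt a
  refine Finset.prod_bij (fun a _ => X ^ i + ∑ j, C (a j) * X ^ (j : ℕ)) ?_ ?_ ?_ fun _ _ => rfl
  · intro a _
    exact (hS _).2 ⟨monic_X_pow_add (hdeg a), natDegree_eq_of_degree_eq_some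
      (by rw [degree_add_eq_left_of_degree_lt] <;> simp [hdeg])⟩
  · intro a _ b _ hab
    funext k
    have := congrArg (fun f => coeff f k) (add_left_cancel hab)
    simpa [finsetSum_coeff, coeff_X_pow, Fin.val_inj] using this
  · intro f hf
    obtain ⟨hm, hd⟩ := (hS f).1 hf
    refine ⟨fun j => f.coeff j, Finset.mem_univ _, ?_⟩
    subst hd
    rw [Fin.sum_univ_eq_sum_range (fun j => C (f.coeff j) * X ^ j)]
    exact hm.as_sum.symm
end

section
/- Let p be a prime, q a power of p, and ρ a permutation of ℕ = {0,1,2,…}. Then there exists a unique continuous function f : ℤ_p → ℤ_p such that f(n) = ρ_*(n) for every natural number n (where natural numbers are regarded in ℤ_p via the canonical embedding). -/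
/-- The digit permutation map on natural numbers: if `n = Σ_i c_i q^i` `q`-adically, then
`rhoStar q ρ n = Σ_i c_i q^{ρ(i)}`.  (For `q ≥ 2` the digits `n / q^i % q` vanish for
`i > n`, so the finite range below suffices.) -/
def rhoStar (q : ℕ) (ρ : Equiv.Perm ℕ) (n : ℕ) : ℕ :=
  ∑ i ∈ Finset.range (n + 1), (n / q ^ i % q) * q ^ (ρ i)

/-- The `i`-th base `p ^ k` digit of a `p`-adic integer. -/
noncomputable def padicDigit (p : ℕ) [Fact p.Prime] (k i : ℕ) (x : ℤ_[p]) : ℕ :=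
  (PadicInt.toZModPow (k * (i + 1)) x).val / (p ^ k) ^ i % p ^ k

theorem continuous_padicDigit (p : ℕ) [Fact p.Prime] (k i : ℕ) :
    Continuous (padicDigit p k i) := by
  refine IsLocallyConstant.continuous (IsLocallyConstant.iff_eventually_eq _ |>.2 fun x => ?_)
  have hp : (0 : ℝ) < (p : ℝ) ^ (-(k * (i + 1) : ℕ) : ℤ) :=
    zpow_pos (by exact_mod_cast (Fact.out : p.Prime).pos) _
  filter_upwards [Metric.closedBall_mem_nhds x hp] with y hy
  rw [Metric.mem_closedBall, dist_eq_norm, PadicInt.norm_le_pow_iff_mem_span_pow,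
    ← PadicInt.ker_toZModPow, RingHom.mem_ker, map_sub, sub_eq_zero] at hy
  rw [padicDigit, padicDigit, hy]

theorem padicDigit_natCast (p : ℕ) [Fact p.Prime] (k i n : ℕ) :
    padicDigit p k i n = n / (p ^ k) ^ i % p ^ k := by
  rw [padicDigit, map_natCast, ZMod.val_natCast, pow_mul, pow_succ,
    Nat.mod_mul_right_div_self, Nat.mod_mod]

theorem norm_natCast_mul_pow_le (p : ℕ) [Fact p.Prime] (k c m : ℕ) :
    ‖((c : ℤ_[p]) * ((p ^ k : ℕ) : ℤ_[p]) ^ m)‖ ≤ (((p : ℝ)⁻¹) ^ k) ^ m := by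
  rw [norm_mul, norm_pow, Nat.cast_pow, norm_pow, PadicInt.norm_p]
  exact mul_le_of_le_one_left (by positivity) (PadicInt.norm_le_one _)

theorem tsum_digits_eq_rhoStar (p : ℕ) [Fact p.Prime] {q : ℕ} (hq : 1 < q)
    (ρ : Equiv.Perm ℕ) (n : ℕ) :
    ∑' i, ((n / q ^ i % q : ℕ) : ℤ_[p]) * (q : ℤ_[p]) ^ ρ i = (rhoStar q ρ n : ℤ_[p]) := by
  rw [tsum_eq_sum (s := Finset.range (n + 1))]
  · simp only [rhoStar, Nat.cast_sum, Nat.cast_mul, Nat.cast_pow]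
  · intro i hi
    have hni : n < i := by rw [Finset.mem_range] at hi; lia
    rw [Nat.div_eq_of_lt (hni.trans (Nat.lt_pow_self hq)), Nat.zero_mod, Nat.cast_zero, zero_mul]

/-- there is a unique continuous function `ℤ_p → ℤ_p` agreeing with the
`q`-adic digit permutation `ρ_*` on the natural numbers. -/
theorem exists_unique_continuous_extension_rhoStar (p : ℕ) [Fact p.Prime] (q : ℕ)
    (hq : ∃ n : ℕ, 0 < n ∧ q = p ^ n) (ρ : Equiv.Perm ℕ) :
    ∃! f : ℤ_[p] → ℤ_[p], Continuous f ∧ ∀ n : ℕ, f (n : ℤ_[p]) = (rhoStar q ρ n : ℤ_[p]) := by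
  obtain ⟨k, hk, rfl⟩ := hq
  have hp : p.Prime := Fact.out
  have hsum : Summable fun i => (((p : ℝ)⁻¹) ^ k) ^ ρ i := by
    refine (ρ.summable_iff (f := fun i => (((p : ℝ)⁻¹) ^ k) ^ i)).2 ?_
    refine summable_geometric_of_lt_one (by positivity) ?_
    exact pow_lt_one₀ (by positivity) (inv_lt_one_of_one_lt₀ (by exact_mod_cast hp.one_lt)) hk.ne'
  let f : ℤ_[p] → ℤ_[p] := fun x =>
    ∑' i, (padicDigit p k i x : ℤ_[p]) * ((p ^ k : ℕ) : ℤ_[p]) ^ ρ i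
  have hf : Continuous f := by
    refine continuous_tsum (fun i => ?_) hsum fun i x => norm_natCast_mul_pow_le p k _ _
    exact (continuous_of_discreteTopology.comp (continuous_padicDigit p k i)).mul continuous_const
  have hfn (n : ℕ) : f n = (rhoStar (p ^ k) ρ n : ℤ_[p]) := by
    simp only [f, padicDigit_natCast]
    exact tsum_digits_eq_rhoStar p (Nat.one_lt_pow hk.ne' hp.one_lt) ρ n
  exact ⟨f, ⟨hf, hfn⟩, fun g hg => PadicInt.denseRange_natCast.equalizer hg.1 hf
    (funext fun n => (hg.2 n).trans (hfn n).symm)⟩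
end

section
/- Let p be a prime, q a power of p, and ρ a permutation of ℕ. Let f : ℤ_p → ℤ_p be any continuous function with f(n) = ρ_*(n) for every natural number n. Then for every negative integer m there exists a negative integer m′ such that f(m) = m′ in ℤ_p and m′ ≡ m (mod q − 1). -/
open Filter Topology

theorem sum_digits_mul_eq_of_lt_pow {q : ℕ} (hq : 2 ≤ q) (g : ℕ → ℕ) {n J K : ℕ}
    (hJ : n < q ^ J) (hK : n < q ^ K) :
    ∑ i ∈ Finset.range J, (n / q ^ i % q) * g i = ∑ i ∈ Finset.range K, (n / q ^ i % q) * g i := by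
  wlog hJK : J ≤ K generalizing J K
  · exact (this hK hJ (le_of_not_ge hJK)).symm
  refine Finset.sum_subset (Finset.range_mono hJK) fun i _ hi ↦ ?_
  have hJi : J ≤ i := by simpa using hi
  rw [Nat.div_eq_of_lt (hJ.trans_le (Nat.pow_le_pow_right (by omega) hJi))]
  simp

theorem rhoStar_eq_sum_range {q : ℕ} (hq : 2 ≤ q) (ρ : Equiv.Perm ℕ) {n J : ℕ}
    (hJ : n < q ^ J) :
    rhoStar q ρ n = ∑ i ∈ Finset.range J, (n / q ^ i % q) * q ^ ρ i :=
  sum_digits_mul_eq_of_lt_pow hq (fun i ↦ q ^ ρ i)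
    ((Nat.lt_pow_self hq).trans_le (Nat.pow_le_pow_right (by omega) n.le_succ)) hJ

theorem sum_range_digits_mul_pow (q n J : ℕ) :
    ∑ i ∈ Finset.range J, (n / q ^ i % q) * q ^ i = n % q ^ J := by
  induction J with
  | zero => simp [Nat.mod_one]
  | succ J ih => rw [Finset.sum_range_succ, ih, Nat.mod_pow_succ, mul_comm (q ^ J)]

theorem digit_add_digit_of_add_eq_pow {q : ℕ} (hq : 2 ≤ q) {J : ℕ} :
    ∀ {x y i : ℕ}, x + y + 1 = q ^ J → i < J → x / q ^ i % q + y / q ^ i % q = q - 1 := by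
  induction J with
  | zero => intro x y i _ hi; omega
  | succ J ih =>
    intro x y i h hi
    have hx := Nat.div_add_mod x q
    have hy := Nat.div_add_mod y q
    have hxl := Nat.mod_lt x (show 0 < q by omega)
    have hyl := Nat.mod_lt y (show 0 < q by omega)
    have hdvd : q ∣ x % q + y % q + 1 := by
      have h1 : q * (x / q + y / q) + (x % q + y % q + 1) = q * q ^ J := by
        rw [← pow_succ', ← h]; linarith
      exact (Nat.dvd_add_right (Dvd.intro _ rfl)).1 (h1 ▸ Dvd.intro _ rfl)
    have hlow : x % q + y % q + 1 = q := by
      obtain ⟨c, hc⟩ := hdvd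
      have hc2 : c < 2 := by by_contra! hc2; nlinarith
      interval_cases c <;> omega
    cases i with
    | zero => simp; omega
    | succ i =>
      rw [pow_succ', ← Nat.div_div_eq_div_mul, ← Nat.div_div_eq_div_mul]
      refine ih ?_ (by omega)
      refine Nat.eq_of_mul_eq_mul_left (show 0 < q by omega) ?_
      rw [← pow_succ', ← h]
      linarith

theorem rhoStar_add_rhoStar_of_add_eq_pow {q : ℕ} (hq : 2 ≤ q) (ρ : Equiv.Perm ℕ) {J x y : ℕ}
    (h : x + y + 1 = q ^ J) :
    rhoStar q ρ x + rhoStar q ρ y = ∑ i ∈ Finset.range J, (q - 1) * q ^ ρ i := by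
  rw [rhoStar_eq_sum_range hq ρ (show x < q ^ J by omega),
    rhoStar_eq_sum_range hq ρ (show y < q ^ J by omega), ← Finset.sum_add_distrib]
  refine Finset.sum_congr rfl fun i hi ↦ ?_
  rw [← add_mul, digit_add_digit_of_add_eq_pow hq h (Finset.mem_range.1 hi)]

theorem rhoStar_modEq {q : ℕ} (hq : 2 ≤ q) (ρ : Equiv.Perm ℕ) (n : ℕ) :
    (rhoStar q ρ n : ℤ) ≡ n [ZMOD ((q : ℤ) - 1)] := by
  have hn : n < q ^ n := Nat.lt_pow_self hq
  have hsum := sum_range_digits_mul_pow q n n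
  rw [Nat.mod_eq_of_lt hn] at hsum
  rw [rhoStar_eq_sum_range hq ρ hn]
  conv_rhs => rw [← hsum]
  push_cast
  have hone (s : ℕ) : (q : ℤ) ^ s ≡ 1 [ZMOD ((q : ℤ) - 1)] := by
    simpa using (Int.modEq_sub (q : ℤ) 1).pow s
  refine Int.modEq_iff_dvd.2 ?_
  rw [← Finset.sum_sub_distrib]
  refine Finset.dvd_sum fun i _ ↦ ?_
  rw [← mul_sub]
  exact Dvd.dvd.mul_left (Int.modEq_iff_dvd.1 ((hone _).trans (hone _).symm)) _

theorem tendsto_sum_range_mul_pow_perm {R : Type*} [NormedRing R] [CompleteSpace R]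
    {x : R} (hx : ‖x‖ < 1) (ρ : Equiv.Perm ℕ) :
    Tendsto (fun J ↦ ∑ i ∈ Finset.range J, (x - 1) * x ^ ρ i) atTop (𝓝 (-1)) := by
  have hsum : HasSum (fun i ↦ (x - 1) * x ^ i) (-1) := by
    have h := (summable_geometric_of_norm_lt_one hx).hasSum.mul_left (x - 1)
    rwa [show (x - 1) * ∑' i, x ^ i = -1 by
      rw [← neg_sub, neg_mul, mul_neg_geom_series x hx]] at h
  exact (ρ.hasSum_iff.2 hsum).tendsto_sum_nat

/-- a continuous extension of `ρ_*` to `ℤ_p` maps each negative integer `m`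
to a negative integer `m′` with `m′ ≡ m (mod q − 1)`. -/
theorem rhoStar_extension_maps_negatives_to_negatives (p : ℕ) [Fact p.Prime] (q : ℕ)
    (hq : ∃ n : ℕ, 0 < n ∧ q = p ^ n) (ρ : Equiv.Perm ℕ)
    (f : ℤ_[p] → ℤ_[p]) (hfc : Continuous f)
    (hfn : ∀ n : ℕ, f (n : ℤ_[p]) = (rhoStar q ρ n : ℤ_[p]))
    (m : ℤ) (hm : m < 0) :
    ∃ m' : ℤ, m' < 0 ∧ f (m : ℤ_[p]) = (m' : ℤ_[p]) ∧ m' ≡ m [ZMOD ((q : ℤ) - 1)] := by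
  obtain ⟨k, hk, hqk⟩ := hq
  have hq2 : 2 ≤ q := by
    rw [hqk]
    exact (Fact.out : p.Prime).two_le.trans (Nat.le_self_pow hk.ne' p)
  have hqnorm : ‖(q : ℤ_[p])‖ < 1 := by
    rw [hqk, Nat.cast_pow, norm_pow]
    exact pow_lt_one₀ (norm_nonneg _) (PadicInt.norm_lt_one_iff_dvd _ |>.2 dvd_rfl) hk.ne'
  obtain ⟨a, rfl⟩ : ∃ a : ℕ, m = -1 - a := ⟨(-1 - m).toNat, by omega⟩
  refine ⟨-1 - rhoStar q ρ a, by omega, ?_, (Int.ModEq.refl _).sub (rhoStar_modEq hq2 ρ a)⟩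
  have hsucc {J : ℕ} (hJ : a ≤ J) : (q ^ J - 1 - a) + a + 1 = q ^ J := by
    have := (Nat.lt_pow_self hq2 : J < q ^ J)
    omega
  have harg : Tendsto (fun J : ℕ ↦ ((q ^ J - 1 - a : ℕ) : ℤ_[p])) atTop
      (𝓝 ((-1 - a : ℤ) : ℤ_[p])) := by
    have h := (tendsto_pow_atTop_nhds_zero_of_norm_lt_one hqnorm).add_const
      (((-1 - a : ℤ) : ℤ_[p]))
    rw [zero_add] at h
    refine h.congr' ?_
    filter_upwards [eventually_ge_atTop a] with J hJ
    have := congrArg (Nat.cast : ℕ → ℤ_[p]) (hsucc hJ)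
    push_cast at this ⊢
    rw [← this]
    ring
  have hval : Tendsto (fun J : ℕ ↦ f ((q ^ J - 1 - a : ℕ) : ℤ_[p])) atTop
      (𝓝 ((-1 - rhoStar q ρ a : ℤ) : ℤ_[p])) := by
    have h := (tendsto_sum_range_mul_pow_perm hqnorm ρ).sub_const (rhoStar q ρ a : ℤ_[p])
    push_cast
    refine h.congr' ?_
    filter_upwards [eventually_ge_atTop a] with J hJ
    have := congrArg (Nat.cast : ℕ → ℤ_[p]) (rhoStar_add_rhoStar_of_add_eq_pow hq2 ρ (hsucc hJ))
    push_cast [Nat.cast_sub (show 1 ≤ q by omega)] at this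
    rw [hfn, ← this]
    ring
  exact tendsto_nhds_unique ((hfc.tendsto _).comp harg) hval
end

section
/- Let p be a prime and ρ a permutation of ℕ, and let ρ_* be the induced p-adic digit permutation (the case q = p). Then for all natural numbers m and k, the binomial coefficients satisfy C(m, k) ≡ C(ρ_*(m), ρ_*(k)) (mod p). -/
theorem sum_range_digits_div_pow_mod {q : ℕ} (c : ℕ → ℕ) (hc : ∀ i, c i < q) (N j : ℕ) :
    (∑ i ∈ Finset.range N, c i * q ^ i) / q ^ j % q = if j < N then c j else 0 := by
  induction N generalizing c j with
  | zero => simp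
  | succ N ih =>
    have hq : 0 < q := (Nat.zero_le _).trans_lt (hc 0)
    have hsum : ∑ i ∈ Finset.range (N + 1), c i * q ^ i =
        c 0 + q * ∑ i ∈ Finset.range N, c (i + 1) * q ^ i := by
      rw [Finset.sum_range_succ', Finset.mul_sum, add_comm]
      congr 1
      · simp
      · exact Finset.sum_congr rfl fun i _ => by ring
    rw [hsum]
    cases j with
    | zero => simp [Nat.mod_eq_of_lt (hc 0)]
    | succ j =>
      rw [pow_succ', ← Nat.div_div_eq_div_mul, Nat.add_mul_div_left _ _ hq,
        Nat.div_eq_of_lt (hc 0), zero_add, ih (fun i => c (i + 1)) fun i => hc _]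
      simp

theorem sum_digits_div_pow_mod {q : ℕ} (c : ℕ → ℕ) (hc : ∀ i, c i < q) (s : Finset ℕ) (j : ℕ) :
    (∑ i ∈ s, c i * q ^ i) / q ^ j % q = if j ∈ s then c j else 0 := by
  obtain ⟨N, hN⟩ := s.exists_nat_subset_range
  have hsum : ∑ i ∈ s, c i * q ^ i =
      ∑ i ∈ Finset.range N, (if i ∈ s then c i else 0) * q ^ i := by
    simp only [ite_mul, zero_mul]
    rw [← Finset.sum_filter, Finset.filter_mem_eq_inter, Finset.inter_eq_right.mpr hN]
  rw [hsum, sum_range_digits_div_pow_mod]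
  · by_cases hj : j ∈ s
    · simp [hj, Finset.mem_range.mp (hN hj)]
    · simp [hj]
  · intro i
    split_ifs
    · exact hc i
    · exact (Nat.zero_le _).trans_lt (hc i)

/-- The digit of `rhoStar q ρ n` at place `ρ j` is the digit of `n` at place `j`. -/
theorem rhoStar_div_pow_mod {q : ℕ} (hq : 1 < q) (ρ : Equiv.Perm ℕ) (n j : ℕ) :
    rhoStar q ρ n / q ^ ρ j % q = n / q ^ j % q := by
  have hsum : rhoStar q ρ n = ∑ i ∈ (Finset.range (n + 1)).map ρ.toEmbedding,
      (n / q ^ ρ.symm i % q) * q ^ i := by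
    simp [rhoStar]
  rw [hsum, sum_digits_div_pow_mod (fun i => n / q ^ ρ.symm i % q)
    fun i => Nat.mod_lt _ (by lia)]
  by_cases hj : j < n + 1
  · simp [hj]
  · have hlt : n < q ^ j := (by lia : n < j).trans (Nat.lt_pow_self hq)
    simp [hj, Nat.div_eq_of_lt hlt]

/-- Lucas's theorem, with the product taken over all digit places. -/
theorem choose_modEq_finprod_choose {p : ℕ} (hp : p.Prime) (m k : ℕ) :
    Nat.choose m k ≡ ∏ᶠ i, Nat.choose (m / p ^ i % p) (k / p ^ i % p) [MOD p] := by
  have : Fact p.Prime := ⟨hp⟩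
  have hlt {n a : ℕ} (h : n ≤ a) : n < p ^ a := h.trans_lt (Nat.lt_pow_self hp.one_lt)
  rw [finprod_eq_prod_of_mulSupport_subset (s := Finset.range (m + k))]
  · exact Choose.choose_modEq_prod_range_choose_nat (hlt (by lia)) (hlt (by lia))
  · intro i hi
    contrapose! hi
    have hle : m + k ≤ i := by simpa using hi
    simp [Nat.div_eq_of_lt (hlt (by lia : m ≤ i)), Nat.div_eq_of_lt (hlt (by lia : k ≤ i))]

/-- `C(m, k) ≡ C(ρ_*(m), ρ_*(k)) (mod p)` for the `p`-adic digit
permutation `ρ_*`. -/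
theorem choose_modEq_choose_rhoStar (p : ℕ) (hp : p.Prime) (ρ : Equiv.Perm ℕ)
    (m k : ℕ) :
    Nat.choose m k ≡ Nat.choose (rhoStar p ρ m) (rhoStar p ρ k) [MOD p] := by
  refine (choose_modEq_finprod_choose hp m k).trans ?_
  refine .trans ?_ (choose_modEq_finprod_choose hp _ _).symm
  rw [← finprod_comp_equiv ρ (f := fun i =>
    Nat.choose (rhoStar p ρ m / p ^ i % p) (rhoStar p ρ k / p ^ i % p))]
  simp only [rhoStar_div_pow_mod hp.one_lt]
  exact Nat.ModEq.refl _
end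

section
/- Let q be a power of a prime p and ρ a permutation of ℕ. Then for all nonnegative integers e and i, the power sum S_e(i) of monic polynomials vanishes if and only if S_e(ρ_*(i)) vanishes: S_e(i) = 0 ⟺ S_e(ρ_*(i)) = 0. -/
open Polynomial

/-- The signed sum of the weights `p ^ g s` over the integers `s` between `0` and `i`. -/
noncomputable def cumWeight (p : ℕ) (g : ℤ → ℤ) (i : ℤ) : ℚ :=
  ∑ s ∈ Finset.Ioc 0 i, (p : ℚ) ^ g s - ∑ s ∈ Finset.Ioc i 0, (p : ℚ) ^ g s

theorem cumWeight_add_one (p : ℕ) (g : ℤ → ℤ) (i : ℤ) :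
    cumWeight p g (i + 1) = cumWeight p g i + (p : ℚ) ^ g (i + 1) := by
  unfold cumWeight
  rcases le_or_gt 0 i with hi | hi
  · have h1 : Finset.Ioc 0 (i + 1) = insert (i + 1) (Finset.Ioc 0 i) := by
      ext s; simp only [Finset.mem_Ioc, Finset.mem_insert]; omega
    have h2 : Finset.Ioc (i + 1) 0 = ∅ := Finset.Ioc_eq_empty (by omega)
    have h3 : Finset.Ioc i 0 = ∅ := Finset.Ioc_eq_empty (by omega)
    rw [h1, h2, h3, Finset.sum_insert (by simp)]
    simp only [Finset.sum_empty]; ring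
  · have h1 : Finset.Ioc i 0 = insert (i + 1) (Finset.Ioc (i + 1) 0) := by
      ext s; simp only [Finset.mem_Ioc, Finset.mem_insert]; omega
    have h2 : Finset.Ioc 0 (i + 1) = ∅ := Finset.Ioc_eq_empty (by omega)
    have h3 : Finset.Ioc 0 i = ∅ := Finset.Ioc_eq_empty (by omega)
    rw [h1, h2, h3, Finset.sum_insert (by simp)]
    simp only [Finset.sum_empty]; ring

theorem cumWeight_sub_of_le (p : ℕ) (g : ℤ → ℤ) {a b : ℤ} (h : a ≤ b) :
    cumWeight p g b - cumWeight p g a = ∑ s ∈ Finset.Ioc a b, (p : ℚ) ^ g s := by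
  induction b, h using Int.leInduction with
  | base => simp
  | succ b hb ih =>
    have h1 : Finset.Ioc a (b + 1) = insert (b + 1) (Finset.Ioc a b) := by
      ext s; simp only [Finset.mem_Ioc, Finset.mem_insert]; omega
    rw [h1, Finset.sum_insert (by simp), cumWeight_add_one, ← ih]; ring

theorem cumWeight_mono (p : ℕ) (g : ℤ → ℤ) : Monotone (cumWeight p g) := by
  intro a b h
  have := cumWeight_sub_of_le p g h
  have h2 : 0 ≤ ∑ s ∈ Finset.Ioc a b, (p : ℚ) ^ g s :=
    Finset.sum_nonneg fun s _ => by positivity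
  linarith

theorem cumWeight_add_le_of_lt (p : ℕ) (g : ℤ → ℤ) {a b : ℤ} (h : a < b) :
    cumWeight p g a + (p : ℚ) ^ g b ≤ cumWeight p g b := by
  have h1 := cumWeight_add_one p g (b - 1)
  rw [sub_add_cancel] at h1
  have h2 := cumWeight_mono p g (show a ≤ b - 1 by omega)
  linarith

theorem cumWeight_shift_le {p : ℕ} (hp : 1 ≤ p) {g : ℤ → ℤ} (hg : Monotone g) (a : ℤ)
    (k d : ℕ) :
    cumWeight p g (a + k) + cumWeight p g (a + d) ≤
      cumWeight p g (a + k + d) + cumWeight p g a := by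
  induction k with
  | zero => simp [add_comm]
  | succ k ih =>
    have h1 := cumWeight_add_one p g (a + k)
    have h2 := cumWeight_add_one p g (a + k + d)
    have h3 : (p : ℚ) ^ g (a + k + 1) ≤ (p : ℚ) ^ g (a + k + d + 1) :=
      zpow_le_zpow_right₀ (by exact_mod_cast hp) (hg (by omega))
    have e1 : a + ((k + 1 : ℕ) : ℤ) = a + k + 1 := by push_cast; ring
    have e2 : a + ((k + 1 : ℕ) : ℤ) + d = a + k + d + 1 := by push_cast; ring
    rw [e2, e1, h1, h2]; linarith

/-- Discrete convexity: moving two arguments towards each other decreases the sum. -/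
theorem cumWeight_exchange {p : ℕ} (hp : 1 ≤ p) {g : ℤ → ℤ} (hg : Monotone g) {u w δ : ℤ}
    (h : (0 ≤ δ ∧ δ ≤ w - u) ∨ (w - u ≤ δ ∧ δ ≤ 0)) :
    cumWeight p g (u + δ) + cumWeight p g (w - δ) ≤ cumWeight p g u + cumWeight p g w := by
  rcases h with ⟨h0, h1⟩ | ⟨h1, h0⟩
  · have := cumWeight_shift_le hp hg u δ.toNat (w - δ - u).toNat
    rw [Int.toNat_of_nonneg h0, Int.toNat_of_nonneg (by omega)] at this
    rw [show u + (w - δ - u) = w - δ by ring, show u + δ + (w - δ - u) = w by ring] at this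
    linarith
  · have := cumWeight_shift_le hp hg w (-δ).toNat (u + δ - w).toNat
    rw [Int.toNat_of_nonneg (by omega), Int.toNat_of_nonneg (by omega)] at this
    rw [show w + (u + δ - w) = u + δ by ring, show w + -δ + (u + δ - w) = u by ring,
      ← sub_eq_add_neg] at this
    linarith

theorem sum_zpow_lt {α : Type*} {p : ℕ} (hp : 1 ≤ p) (S : Finset α) (g : α → ℤ) {t : ℤ}
    (hlt : ∀ x ∈ S, g x < t) (hf : ∀ s, (S.filter fun x => g x = s).card ≤ p - 1) :
    ∑ x ∈ S, (p : ℚ) ^ g x < (p : ℚ) ^ t := by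
  have hp0 : (0 : ℚ) < p := by exact_mod_cast hp
  obtain ⟨m, hmt, hm⟩ : ∃ m ≤ t, ∀ x ∈ S, m ≤ g x := by
    obtain ⟨m, hm⟩ := (S.image g).bddBelow
    exact ⟨min m t, min_le_right _ _, fun x hx =>
      (min_le_left _ _).trans (hm (by simpa using ⟨x, hx, rfl⟩))⟩
  have hgeom : ∀ b, m ≤ b →
      ∑ s ∈ Finset.Ico m b, ((p : ℚ) - 1) * (p : ℚ) ^ s = (p : ℚ) ^ b - (p : ℚ) ^ m := by
    intro b hb
    induction b, hb using Int.leInduction with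
    | base => simp
    | succ b hb ih =>
      have h1 : Finset.Ico m (b + 1) = insert b (Finset.Ico m b) := by
        ext s; simp only [Finset.mem_Ico, Finset.mem_insert]; omega
      rw [h1, Finset.sum_insert (by simp), ih, zpow_add_one₀ hp0.ne']; ring
  have hm0 : (0 : ℚ) < (p : ℚ) ^ m := by positivity
  calc ∑ x ∈ S, (p : ℚ) ^ g x
      = ∑ s ∈ Finset.Ico m t, ∑ x ∈ S with g x = s, (p : ℚ) ^ g x :=
        (Finset.sum_fiberwise_of_maps_to
          (fun x hx => Finset.mem_Ico.2 ⟨hm x hx, hlt x hx⟩) _).symm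
    _ ≤ ∑ s ∈ Finset.Ico m t, ((p : ℚ) - 1) * (p : ℚ) ^ s := by
        refine Finset.sum_le_sum fun s _ => ?_
        rw [Finset.sum_congr rfl (g := fun _ => (p : ℚ) ^ s)
          (fun x hx => by rw [(Finset.mem_filter.1 hx).2]), Finset.sum_const, nsmul_eq_mul]
        have : ((S.filter fun x => g x = s).card : ℚ) ≤ (p : ℚ) - 1 := by
          have := hf s
          rw [le_sub_iff_add_le]; exact_mod_cast (by omega)
        gcongr
    _ < (p : ℚ) ^ t := by rw [hgeom t hmt]; linarith

/-- A family of enumerations, one for each residue class, of the positions of the digits of a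
number; every position is listed at most `p - 1` times. -/
structure IsPositionSystem {ι : Type*} (p : ℕ) (pos : ι → ℤ → ℤ) : Prop where
  mono : ∀ l, Monotone (pos l)
  lt : ∀ l i, pos l i < pos l (i + (p - 1))
  inj : ∀ l l' i i', pos l i = pos l' i' → l = l'

section

variable {ι : Type*} [Fintype ι] {p : ℕ} {pos : ι → ℤ → ℤ}

theorem sum_cumWeight_lt (hp : 2 ≤ p) (hpos : IsPositionSystem p pos)
    {v v' : ι → ℤ} {c : ι} (hc : v' c < v c)
    (htop : ∀ l, v l < v' l → pos l (v' l) < pos c (v c)) :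
    ∑ l, cumWeight p (pos l) (v' l) < ∑ l, cumWeight p (pos l) (v l) := by
  classical
  have hpt : ∀ l, cumWeight p (pos l) (v' l) - cumWeight p (pos l) (v l) ≤
      ∑ s ∈ Finset.Ioc (v l) (v' l), (p : ℚ) ^ pos l s -
        if l = c then (p : ℚ) ^ pos c (v c) else 0 := by
    intro l
    rcases lt_or_ge (v l) (v' l) with h | h
    · have hlc : l ≠ c := by rintro rfl; omega
      rw [if_neg hlc, cumWeight_sub_of_le _ _ h.le, sub_zero]
    · rw [Finset.Ioc_eq_empty (by omega), Finset.sum_empty]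
      split_ifs with hlc
      · subst hlc
        have := cumWeight_add_le_of_lt p (pos l) hc
        linarith
      · have := cumWeight_mono p (pos l) h
        linarith
  have hsum := Finset.sum_le_sum fun l (_ : l ∈ Finset.univ) => hpt l
  rw [Finset.sum_sub_distrib, Finset.sum_sub_distrib, Finset.sum_ite_eq' Finset.univ c,
    if_pos (Finset.mem_univ c), Finset.sum_sigma' Finset.univ
      (fun l => Finset.Ioc (v l) (v' l)) (fun l s => (p : ℚ) ^ pos l s)] at hsum
  have hlt := sum_zpow_lt (by omega : 1 ≤ p)
    (Finset.univ.sigma fun l => Finset.Ioc (v l) (v' l)) (fun x => pos x.1 x.2)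
    (t := pos c (v c)) ?_ ?_
  · linarith
  · rintro ⟨l, s⟩ hs
    simp only [Finset.mem_sigma, Finset.mem_univ, true_and, Finset.mem_Ioc] at hs
    exact (hpos.mono l hs.2).trans_lt (htop l (by omega))
  · intro s
    rcases (Finset.filter (fun x : (_ : ι) × ℤ => pos x.1 x.2 = s)
      (Finset.univ.sigma fun l => Finset.Ioc (v l) (v' l))).eq_empty_or_nonempty with h | h
    · rw [h]; simp
    · obtain ⟨⟨l, i⟩, hx, hmin⟩ := Finset.exists_min_image _ (fun x => x.2) h
      have hx' := (Finset.mem_filter.1 hx).2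
      calc _ ≤ ((Finset.Ico i (i + (p - 1))).map ⟨fun j => (⟨l, j⟩ : (_ : ι) × ℤ),
              fun a b hab => by simpa using hab⟩).card := by
            refine Finset.card_le_card ?_
            rintro ⟨l', j⟩ hj
            have hij := hmin _ hj
            have hj' := (Finset.mem_filter.1 hj).2
            simp only at hij hj' hx'
            obtain rfl : l = l' := hpos.inj _ _ _ _ (hx'.trans hj'.symm)
            simp only [Finset.mem_map, Finset.mem_Ico]
            refine ⟨j, ⟨hij, ?_⟩, rfl⟩
            by_contra hcon
            have := hpos.mono l (not_lt.1 hcon)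
            have := hpos.lt l i
            omega
        _ = p - 1 := by
            rw [Finset.card_map, Int.card_Ico]; omega

theorem sum_cumWeight_lt_or_lt (hp : 2 ≤ p) (hpos : IsPositionSystem p pos)
    {v v' : ι → ℤ} (hne : v ≠ v') :
    (∑ l, cumWeight p (pos l) (v' l) < ∑ l, cumWeight p (pos l) (v l) ∧
      ∃ c, v' c < v c ∧ ∀ l, v l < v' l → pos l (v' l) < pos c (v c)) ∨
    (∑ l, cumWeight p (pos l) (v l) < ∑ l, cumWeight p (pos l) (v' l) ∧
      ∃ c, v c < v' c ∧ ∀ l, v' l < v l → pos l (v l) < pos c (v' c)) := by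
  classical
  obtain ⟨c₀, hc₀⟩ := Function.ne_iff.1 hne
  obtain ⟨c, hc, hmax⟩ := Finset.exists_max_image (Finset.univ.filter fun l => v l ≠ v' l)
    (fun l => pos l (max (v l) (v' l))) ⟨c₀, by simpa using hc₀⟩
  simp only [Finset.mem_filter, Finset.mem_univ, true_and] at hc hmax
  rcases lt_or_gt_of_ne hc with h | h
  · right
    have htop : ∀ l, v' l < v l → pos l (v l) < pos c (v' c) := by
      intro l hl
      have := hmax l hl.ne'
      rw [max_eq_left hl.le, max_eq_right h.le] at this
      refine lt_of_le_of_ne this fun heq => ?_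
      obtain rfl := hpos.inj _ _ _ _ heq
      omega
    exact ⟨sum_cumWeight_lt hp hpos h htop, c, h, htop⟩
  · left
    have htop : ∀ l, v l < v' l → pos l (v' l) < pos c (v c) := by
      intro l hl
      have := hmax l hl.ne
      rw [max_eq_right hl.le, max_eq_left h.le] at this
      refine lt_of_le_of_ne this fun heq => ?_
      obtain rfl := hpos.inj _ _ _ _ heq
      omega
    exact ⟨sum_cumWeight_lt hp hpos h htop, c, h, htop⟩

end

section

variable {n : ℕ} {p : ℕ}

/-- The vector `p U_l - U_{l-1}`, indexed by the residue classes modulo `n`. -/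
def stepVec (p : ℕ) (U : ZMod n → ℤ) (l : ZMod n) : ℤ := p * U l - U (l - 1)

theorem stepVec_add (U W : ZMod n → ℤ) (l : ZMod n) :
    stepVec p (U + W) l = stepVec p U l + stepVec p W l := by
  simp only [stepVec, Pi.add_apply]; ring

theorem stepVec_sub (U W : ZMod n → ℤ) (l : ZMod n) :
    stepVec p (U - W) l = stepVec p U l - stepVec p W l := by
  simp only [stepVec, Pi.sub_apply]; ring

variable [NeZero n]

theorem nonneg_of_stepVec_nonneg (hp : 2 ≤ p) {U : ZMod n → ℤ} (h : ∀ l, 0 ≤ stepVec p U l)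
    (l : ZMod n) : 0 ≤ U l := by
  obtain ⟨m, hm⟩ := Finite.exists_min U
  refine le_trans ?_ (hm l)
  have h1 := h m
  have h2 := hm (m - 1)
  have hp' : (2 : ℤ) ≤ p := by exact_mod_cast hp
  unfold stepVec at h1
  nlinarith

theorem one_le_of_stepVec_nonneg (hp : 2 ≤ p) {U : ZMod n → ℤ} (h : ∀ l, 0 ≤ stepVec p U l)
    (hU : U ≠ 0) (l : ZMod n) : 1 ≤ U l := by
  have h0 := nonneg_of_stepVec_nonneg hp h
  by_contra hl
  have hl0 : U l = 0 := by have := h0 l; omega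
  have hk : ∀ k : ℕ, U (l - k) = 0 := by
    intro k
    induction k with
    | zero => simpa using hl0
    | succ k ih =>
      have h1 := h (l - k)
      have h2 := h0 (l - k - 1)
      rw [stepVec, ih] at h1
      rw [show l - ((k + 1 : ℕ) : ZMod n) = l - k - 1 by push_cast; ring]
      omega
  refine hU (funext fun m => ?_)
  have := hk (l - m).val
  rwa [ZMod.natCast_zmod_val, sub_sub_cancel] at this

theorem stepVec_injective (hp : 2 ≤ p) : Function.Injective (stepVec p : (ZMod n → ℤ) → _) := by
  intro U W h
  have h1 : ∀ l, 0 ≤ stepVec p (U - W) l := fun l => by rw [stepVec_sub, h]; simp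
  have h2 : ∀ l, 0 ≤ stepVec p (W - U) l := fun l => by rw [stepVec_sub, h]; simp
  funext l
  have h3 := nonneg_of_stepVec_nonneg hp h1 l
  have h4 := nonneg_of_stepVec_nonneg hp h2 l
  simp only [Pi.sub_apply] at h3 h4
  omega

theorem sum_stepVec (U : ZMod n → ℤ) : ∑ l, stepVec p U l = (p - 1) * ∑ l, U l := by
  simp only [stepVec, Finset.sum_sub_distrib, ← Finset.mul_sum]
  have h : ∑ l, U (l - 1) = ∑ l, U l := Equiv.sum_comp (Equiv.subRight (1 : ZMod n)) U
  rw [h]; ring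

/-- The total weight of the `stepVec p U l` smallest positions in each class. -/
noncomputable def energy (p : ℕ) (pos : ZMod n → ℤ → ℤ) (U : ZMod n → ℤ) : ℚ :=
  ∑ l, cumWeight p (pos l) (stepVec p U l)

variable {pos : ZMod n → ℤ → ℤ}

theorem energy_injective (hp : 2 ≤ p) (hpos : IsPositionSystem p pos) :
    Function.Injective (energy p pos) := by
  intro U W h
  by_contra hne
  rcases sum_cumWeight_lt_or_lt hp hpos (fun h => hne (stepVec_injective hp h)) with h' | h'
  · exact h'.1.ne' h
  · exact h'.1.ne h

theorem energy_exchange (hp : 2 ≤ p) (hpos : IsPositionSystem p pos) {U W H : ZMod n → ℤ}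
    (h : ∀ l, (0 ≤ stepVec p H l ∧ stepVec p H l ≤ stepVec p (W - U) l) ∨
      (stepVec p (W - U) l ≤ stepVec p H l ∧ stepVec p H l ≤ 0)) :
    energy p pos (U + H) + energy p pos (W - H) ≤ energy p pos U + energy p pos W := by
  simp only [energy, ← Finset.sum_add_distrib]
  refine Finset.sum_le_sum fun l _ => ?_
  rw [stepVec_add, stepVec_sub]
  refine cumWeight_exchange (by omega) (hpos.mono l) ?_
  rw [← stepVec_sub]
  exact h l

theorem energy_sup_add_energy_inf_le (hp : 2 ≤ p) (hpos : IsPositionSystem p pos)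
    (U W : ZMod n → ℤ) :
    energy p pos (U ⊔ W) + energy p pos (U ⊓ W) ≤ energy p pos U + energy p pos W := by
  have h1 : U ⊔ W = U + (W - U) ⊔ 0 := by
    funext l; simp only [Pi.sup_apply, Pi.add_apply, Pi.sub_apply, Pi.zero_apply]; omega
  have h2 : U ⊓ W = W - (W - U) ⊔ 0 := by
    funext l; simp only [Pi.sup_apply, Pi.inf_apply, Pi.sub_apply, Pi.zero_apply]; omega
  rw [h1, h2]
  refine energy_exchange hp hpos fun l => ?_
  simp only [stepVec, Pi.sup_apply, Pi.sub_apply, Pi.zero_apply]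
  generalize W l - U l = a
  generalize W (l - 1) - U (l - 1) = b
  have hp0 : (0 : ℤ) ≤ p := by positivity
  rcases le_total 0 a with ha | ha <;> rcases le_total 0 b with hb | hb
  · rw [max_eq_left ha, max_eq_left hb]; omega
  · rw [max_eq_left ha, max_eq_right hb]
    have := mul_nonneg hp0 ha
    omega
  · rw [max_eq_right ha, max_eq_left hb]
    have := mul_nonpos_of_nonneg_of_nonpos hp0 ha
    rw [mul_zero]; omega
  · rw [max_eq_right ha, max_eq_right hb]
    have := mul_nonpos_of_nonneg_of_nonpos hp0 ha
    rw [mul_zero]; omega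

/-- Chains of vectors, bounded by `B`, whose entries increase by at least one at each level. -/
structure IsSpacedChain (e : ℕ) (B : ℤ) (U : Fin (e + 1) → ZMod n → ℤ) : Prop where
  lower : ∀ (j : Fin (e + 1)) l, ((j : ℕ) : ℤ) ≤ U j l
  spaced : ∀ i j : Fin (e + 1), i ≤ j → ∀ l, U i l - ((i : ℕ) : ℤ) ≤ U j l - ((j : ℕ) : ℤ)
  upper : ∀ j l, U j l ≤ B

/-- Spaced chains of minimal total energy. -/
structure IsOptimalChain (p : ℕ) (pos : ZMod n → ℤ → ℤ) (e : ℕ) (B : ℤ)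
    (U : Fin (e + 1) → ZMod n → ℤ) : Prop extends IsSpacedChain e B U where
  le : ∀ U', IsSpacedChain e B U' → ∑ j, energy p pos (U j) ≤ ∑ j, energy p pos (U' j)

theorem IsSpacedChain.exists_isOptimalChain {e : ℕ} {B : ℤ} {U : Fin (e + 1) → ZMod n → ℤ}
    (h : IsSpacedChain e B U) : ∃ U', IsOptimalChain p pos e B U' := by
  have hfin : {U : Fin (e + 1) → ZMod n → ℤ | IsSpacedChain e B U}.Finite := by
    refine (Set.finite_Icc (0 : Fin (e + 1) → ZMod n → ℤ) fun _ _ => B).subset ?_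
    intro U (hU : IsSpacedChain e B U)
    exact ⟨fun j l => (Int.natCast_nonneg _).trans (hU.lower j l), hU.upper⟩
  obtain ⟨U', hU', hmin⟩ := Set.exists_min_image _ (fun U => ∑ j, energy p pos (U j)) hfin ⟨U, h⟩
  exact ⟨U', hU', hmin⟩

theorem IsSpacedChain.exists_sum_energy_lt (hp : 2 ≤ p) (hpos : IsPositionSystem p pos)
    {e : ℕ} {B : ℤ} {U : Fin (e + 1) → ZMod n → ℤ} (hU : IsSpacedChain e B U)
    {J : Fin (e + 1)} {W : ZMod n → ℤ} (hJW : ∀ l, ((J : ℕ) : ℤ) ≤ W l) (hWU : W ≤ U J)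
    (hlt : energy p pos W < energy p pos (U J)) :
    ∃ U', IsSpacedChain e B U' ∧ ∑ j, energy p pos (U' j) < ∑ j, energy p pos (U j) := by
  classical
  have hp2 : (2 : ℤ) ≤ p := by exact_mod_cast hp
  have hne : stepVec p (U J) ≠ stepVec p W := by
    intro h
    rw [stepVec_injective hp h] at hlt
    exact lt_irrefl _ hlt
  obtain ⟨c, hc, htop⟩ : ∃ c, stepVec p W c < stepVec p (U J) c ∧
      ∀ l, stepVec p (U J) l < stepVec p W l →
        pos l (stepVec p W l) < pos c (stepVec p (U J) c) := by
    rcases sum_cumWeight_lt_or_lt hp hpos hne with h | h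
    · exact h.2
    · exact absurd h.1 hlt.not_gt
  set v := stepVec p (U J) with hv
  set t := pos c (v c) with ht
  set T : Finset (ZMod n) := Finset.univ.filter fun l => W l < U J l ∧ t ≤ pos l (v l + 1) with hT
  have hcT : c ∈ T := by
    simp only [hT, Finset.mem_filter, Finset.mem_univ, true_and]
    refine ⟨?_, hpos.mono c (by omega)⟩
    have h1 := hWU (c - 1)
    by_contra hcon
    have h2 : W c = U J c := le_antisymm (hWU c) (not_lt.1 hcon)
    simp only [hv, stepVec, h2] at hc
    linarith
  have hTpred : ∀ l, l - 1 ∈ T → l ∉ T → pos l (v l + 1) < t := by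
    intro l h1 h2
    simp only [hT, Finset.mem_filter, Finset.mem_univ, true_and, not_and, not_le] at h1 h2
    by_contra hcon
    have h3 : W l = U J l := by
      by_contra hne
      exact hcon (h2 (lt_of_le_of_ne (hWU l) hne))
    have h4 : v l + 1 ≤ stepVec p W l := by
      simp only [hv, stepVec, h3]; omega
    exact hcon ((hpos.mono l h4).trans_lt (htop l (by omega)))
  set D : Fin (e + 1) → ZMod n → Prop := fun i l =>
    i ≤ J ∧ l ∈ T ∧ U i l - ((i : ℕ) : ℤ) = U J l - ((J : ℕ) : ℤ) with hD
  have hVdiff : ∀ i i' l, i ≤ i' → i' ≤ J → D i (l - 1) →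
      stepVec p (U i) l + (p - 1) * (((i' : ℕ) : ℤ) - ((i : ℕ) : ℤ)) +
        p * ((U i' l - ((i' : ℕ) : ℤ)) - (U i l - ((i : ℕ) : ℤ))) = stepVec p (U i') l := by
    intro i i' l h1 h2 h3
    have h4 := hU.spaced i i' h1 (l - 1)
    have h5 := hU.spaced i' J h2 (l - 1)
    have h6 : U i' (l - 1) = U i (l - 1) - ((i : ℕ) : ℤ) + ((i' : ℕ) : ℤ) := by
      have := h3.2.2
      omega
    simp only [stepVec, h6]; ring
  set G : Finset (Fin (e + 1) × ZMod n) :=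
    Finset.univ.filter fun x => ¬ D x.1 x.2 ∧ D x.1 (x.2 - 1) with hG
  have hGinj : ∀ x ∈ G, ∀ y ∈ G, pos x.2 (stepVec p (U x.1) x.2 + 1) =
      pos y.2 (stepVec p (U y.1) y.2 + 1) → x = y := by
    have key : ∀ i i' l, i < i' → D i (l - 1) → D i' (l - 1) →
        pos l (stepVec p (U i) l + 1) < pos l (stepVec p (U i') l + 1) := by
      intro i i' l h1 h2 h3
      have h4 := hVdiff i i' l h1.le h3.1 h2
      have h5 := hU.spaced i i' h1.le l
      have h6 : ((i : ℕ) : ℤ) + 1 ≤ ((i' : ℕ) : ℤ) := by exact_mod_cast h1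
      refine (hpos.lt l _).trans_le (hpos.mono l ?_)
      nlinarith
    rintro ⟨i, l⟩ hx ⟨i', l'⟩ hy hxy
    simp only [hG, Finset.mem_filter, Finset.mem_univ, true_and] at hx hy hxy
    obtain rfl := hpos.inj _ _ _ _ hxy
    rcases lt_trichotomy i i' with h | h | h
    · exact absurd hxy (key _ _ _ h hx.2 hy.2).ne
    · rw [h]
    · exact absurd hxy (key _ _ _ h hy.2 hx.2).ne'
  set κ : Fin (e + 1) × ZMod n → ZMod n := fun x => if x.2 ∈ T then x.2 else c with hκ
  have hκT : ∀ x ∈ G, κ x ∈ T := by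
    intro x _
    simp only [hκ]
    split_ifs with h
    · exact h
    · exact hcT
  have hGlt : ∀ x ∈ G, pos x.2 (stepVec p (U x.1) x.2 + 1) < pos (κ x) (v (κ x)) := by
    rintro ⟨i, l⟩ hx
    simp only [hG, Finset.mem_filter, Finset.mem_univ, true_and] at hx
    obtain ⟨hx1, hx2⟩ := hx
    have h4 := hVdiff i J l hx2.1 le_rfl hx2
    have h5 := hU.spaced i J hx2.1 l
    have h6 : ((i : ℕ) : ℤ) ≤ ((J : ℕ) : ℤ) := by exact_mod_cast hx2.1
    simp only [hκ]
    split_ifs with h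
    · have h7 : U i l - ((i : ℕ) : ℤ) ≠ U J l - ((J : ℕ) : ℤ) := fun h' => hx1 ⟨hx2.1, h, h'⟩
      have h8 : U i l - ((i : ℕ) : ℤ) + 1 ≤ U J l - ((J : ℕ) : ℤ) := by omega
      refine (hpos.lt l _).trans_le (hpos.mono l ?_)
      rw [hv]
      nlinarith
    · refine (hpos.mono l ?_).trans_lt (hTpred l hx2.2.1 h)
      rw [hv]
      nlinarith
  have hgain : ∑ x ∈ G, (p : ℚ) ^ pos x.2 (stepVec p (U x.1) x.2 + 1) <
      ∑ l ∈ T, (p : ℚ) ^ pos l (v l) := by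
    rw [← Finset.sum_fiberwise_of_maps_to hκT]
    refine Finset.sum_lt_sum_of_nonempty ⟨c, hcT⟩ fun l _ => ?_
    refine sum_zpow_lt (by omega) _ (fun x : Fin (e + 1) × ZMod n =>
      pos x.2 (stepVec p (U x.1) x.2 + 1)) ?_ fun s => ?_
    · intro x hx
      rw [Finset.mem_filter] at hx
      have := hGlt x hx.1
      rwa [hx.2] at this
    · refine (Finset.card_le_one.2 ?_).trans (by omega)
      intro x hx y hy
      simp only [Finset.mem_filter] at hx hy
      exact hGinj x hx.1.1 y hy.1.1 (hx.2.trans hy.2.symm)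
  refine ⟨fun i l => U i l - if D i l then 1 else 0, ⟨?_, ?_, ?_⟩, ?_⟩
  · intro i l
    have h1 := hU.lower i l
    split_ifs with h
    · obtain ⟨-, h2, h3⟩ := h
      simp only [hT, Finset.mem_filter, Finset.mem_univ, true_and] at h2
      have := hJW l
      omega
    · omega
  · intro i j hij l
    have h1 := hU.spaced i j hij l
    by_cases hj : D j l
    · by_cases hi : D i l
      · simp only [if_pos hi, if_pos hj]; omega
      · simp only [if_neg hi, if_pos hj]
        have : U i l - ((i : ℕ) : ℤ) ≠ U j l - ((j : ℕ) : ℤ) := fun h =>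
          hi ⟨hij.trans hj.1, hj.2.1, h.trans hj.2.2⟩
        omega
    · rw [if_neg hj]
      split_ifs <;> omega
  · intro j l
    have := hU.upper j l
    split_ifs <;> omega
  · have hpt : ∀ i l, cumWeight p (pos l) (stepVec p (fun l => U i l - if D i l then 1 else 0) l)
        ≤ cumWeight p (pos l) (stepVec p (U i) l) +
          ((if ¬ D i l ∧ D i (l - 1) then (p : ℚ) ^ pos l (stepVec p (U i) l + 1) else 0) -
          if i = J ∧ l ∈ T then (p : ℚ) ^ pos l (v l) else 0) := by
      intro i l
      by_cases hi : D i l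
      · have h1 : stepVec p (fun l => U i l - if D i l then 1 else 0) l <
            stepVec p (U i) l := by
          simp only [stepVec, if_pos hi]
          split_ifs <;> linarith
        have h2 := cumWeight_add_le_of_lt p (pos l) h1
        rw [if_neg (by tauto)]
        split_ifs with h
        · obtain ⟨rfl, -⟩ := h
          rw [hv]; linarith
        · have : (0 : ℚ) ≤ (p : ℚ) ^ pos l (stepVec p (U i) l) := by positivity
          linarith
      · rw [if_neg (show ¬ (i = J ∧ l ∈ T) from fun h => hi ⟨h.1.le, h.2, by rw [h.1]⟩)]
        by_cases hi' : D i (l - 1)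
        · have h1 : stepVec p (fun l => U i l - if D i l then 1 else 0) l =
              stepVec p (U i) l + 1 := by
            simp only [stepVec, if_neg hi, if_pos hi']; ring
          rw [h1, if_pos ⟨hi, hi'⟩, cumWeight_add_one, sub_zero]
        · have h1 : stepVec p (fun l => U i l - if D i l then 1 else 0) l =
              stepVec p (U i) l := by
            simp only [stepVec, if_neg hi, if_neg hi']; ring
          rw [h1, if_neg (by tauto)]; simp
    have hsum : ∑ i, energy p pos (fun l => U i l - if D i l then 1 else 0) ≤
        ∑ i, energy p pos (U i) + (∑ x ∈ G, (p : ℚ) ^ pos x.2 (stepVec p (U x.1) x.2 + 1) -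
          ∑ l ∈ T, (p : ℚ) ^ pos l (v l)) := by
      have h1 := Finset.sum_le_sum fun i (_ : i ∈ Finset.univ) =>
        Finset.sum_le_sum fun l (_ : l ∈ Finset.univ) => hpt i l
      simp only [Finset.sum_add_distrib, Finset.sum_sub_distrib] at h1
      refine h1.trans (le_of_eq ?_)
      congr 2
      · rw [hG, Finset.sum_filter, Fintype.sum_prod_type]
      · rw [Finset.sum_eq_single J]
        · simp only [true_and]
          rw [← Finset.sum_filter]
          simp
        · intro i _ hi
          simp [hi]
        · simp
    linarith
end

section

variable {n p : ℕ} [NeZero n] {pos : ZMod n → ℤ → ℤ} {e : ℕ} {B : ℤ}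
  {U U' : Fin (e + 1) → ZMod n → ℤ}

/-- Each level of an optimal chain has the least energy among the vectors that are compatible with
the higher levels. -/
theorem IsOptimalChain.energy_le (hp : 2 ≤ p) (hpos : IsPositionSystem p pos)
    (hU : IsOptimalChain p pos e B U) {J : Fin (e + 1)} {Z : ZMod n → ℤ}
    (h1 : ∀ l, ((J : ℕ) : ℤ) ≤ Z l)
    (h2 : ∀ j, J < j → ∀ l, Z l - ((J : ℕ) : ℤ) ≤ U j l - ((j : ℕ) : ℤ)) (h3 : ∀ l, Z l ≤ B) :
    energy p pos (U J) ≤ energy p pos Z := by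
  classical
  set S : Set (ZMod n → ℤ) := {Z | (∀ l, ((J : ℕ) : ℤ) ≤ Z l) ∧
    (∀ j, J < j → ∀ l, Z l - ((J : ℕ) : ℤ) ≤ U j l - ((j : ℕ) : ℤ)) ∧ ∀ l, Z l ≤ B} with hS
  have hfin : S.Finite :=
    (Set.finite_Icc (fun _ => ((J : ℕ) : ℤ)) (fun _ => B)).subset fun Z hZ => ⟨hZ.1, hZ.2.2⟩
  obtain ⟨W, hW, hmin⟩ := Set.exists_min_image S (energy p pos) hfin ⟨Z, h1, h2, h3⟩
  refine le_trans ?_ (hmin Z ⟨h1, h2, h3⟩)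
  by_contra! hlt
  have hsup : energy p pos (U J) ≤ energy p pos (U J ⊔ W) := by
    have hchain : IsSpacedChain e B (Function.update U J (U J ⊔ W)) := by
      refine ⟨fun j l => ?_, fun i j hij l => ?_, fun j l => ?_⟩
      · rcases eq_or_ne j J with rfl | hj
        · rw [Function.update_self]
          exact le_sup_of_le_left (hU.lower j l)
        · rw [Function.update_of_ne hj]
          exact hU.lower j l
      · have h4 := hU.spaced i j hij l
        rcases eq_or_ne i J with rfl | hi
        · rcases eq_or_ne j i with rfl | hj
          · rfl
          · rw [Function.update_self, Function.update_of_ne hj]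
            have h5 := hW.2.1 j (lt_of_le_of_ne hij hj.symm) l
            rw [Pi.sup_apply]
            omega
        · rw [Function.update_of_ne hi]
          rcases eq_or_ne j J with rfl | hj
          · rw [Function.update_self, Pi.sup_apply]
            omega
          · rwa [Function.update_of_ne hj]
      · rcases eq_or_ne j J with rfl | hj
        · rw [Function.update_self]
          exact sup_le (hU.upper j l) (hW.2.2 l)
        · rw [Function.update_of_ne hj]
          exact hU.upper j l
    have h4 := hU.le _ hchain
    rw [← Finset.add_sum_erase _ _ (Finset.mem_univ J),
      ← Finset.add_sum_erase _ _ (Finset.mem_univ J), Function.update_self] at h4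
    have h5 : ∑ j ∈ Finset.univ.erase J, energy p pos (Function.update U J (U J ⊔ W) j) =
        ∑ j ∈ Finset.univ.erase J, energy p pos (U j) :=
      Finset.sum_congr rfl fun j hj => by
        rw [Function.update_of_ne (Finset.ne_of_mem_erase hj)]
    linarith
  have hinf : energy p pos W ≤ energy p pos (U J ⊓ W) := by
    refine hmin _ ⟨fun l => le_inf (hU.lower J l) (hW.1 l), fun j hj l => ?_, fun l =>
      inf_le_of_right_le (hW.2.2 l)⟩
    have := hW.2.1 j hj l
    rw [Pi.inf_apply]
    omega
  have hsub := energy_sup_add_energy_inf_le hp hpos (U J) W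
  have heq : U J ⊓ W = W := energy_injective hp hpos (le_antisymm (by linarith) hinf)
  obtain ⟨U', hU', hlt'⟩ := hU.toIsSpacedChain.exists_sum_energy_lt hp hpos hW.1
    (inf_eq_right.1 heq) hlt
  exact (hU.le U' hU').not_gt hlt'

theorem IsOptimalChain.unique (hp : 2 ≤ p) (hpos : IsPositionSystem p pos)
    (hU : IsOptimalChain p pos e B U) (hU' : IsOptimalChain p pos e B U') : U = U' := by
  funext J
  induction J using WellFoundedGT.induction with
  | ind J ih =>
    refine energy_injective hp hpos (le_antisymm ?_ ?_)
    · refine hU.energy_le hp hpos (hU'.lower J) (fun j hj l => ?_) (hU'.upper J)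
      rw [ih j hj]
      exact hU'.spaced J j hj.le l
    · refine hU'.energy_le hp hpos (hU.lower J) (fun j hj l => ?_) (hU.upper J)
      rw [← ih j hj]
      exact hU.spaced J j hj.le l

theorem exists_geometric (hp : 1 ≤ p) (a : ZMod n) {x : ℤ} (hx : 0 ≤ x) :
    ∃ c : ZMod n → ℤ, c a = x ∧ (∀ m, m ≠ a + 1 → c (m - 1) = p * c m) ∧ ∀ m, x ≤ c m := by
  refine ⟨fun m => p ^ (a - m).val * x, by simp, fun m hm => ?_, fun m => ?_⟩
  · have h1 : (a - (m - 1)).val = (a - m).val + 1 := by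
      rcases Nat.lt_or_ge 1 n with hn | hn
      · have : Fact (1 < n) := ⟨hn⟩
        have h2 : (a - m).val + 1 ≠ n := by
          intro h
          apply hm
          have h3 : (((a - m).val + 1 : ℕ) : ZMod n) = 0 := by rw [h]; simp
          rw [Nat.cast_add, ZMod.natCast_zmod_val, Nat.cast_one] at h3
          linear_combination -h3
        have h4 := (a - m).val_lt
        rw [← ZMod.val_one n, ← ZMod.val_add_of_lt]
        · congr 1; ring
        · rw [ZMod.val_one]; omega
      · have : n = 1 := le_antisymm hn NeZero.one_le
        subst this
        exact absurd (Subsingleton.elim _ _) hm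
    simp only [h1, pow_succ]; ring
  · have : (1 : ℤ) ≤ (p : ℤ) ^ (a - m).val := one_le_pow₀ (by exact_mod_cast hp)
    nlinarith

theorem IsOptimalChain.stepVec_le_succ (hp : 2 ≤ p) (hpos : IsPositionSystem p pos)
    (hU : IsOptimalChain p pos e B U) (J : Fin e) (l : ZMod n) :
    stepVec p (U J.castSucc) l ≤ stepVec p (U J.succ) l := by
  have hp2 : (2 : ℤ) ≤ p := by exact_mod_cast hp
  set W := U J.castSucc with hW
  set Z := U J.succ with hZ
  have hWlow : ∀ m, ((J : ℕ) : ℤ) ≤ W m := fun m => by simpa using hU.lower J.castSucc m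
  have hZup : ∀ m, Z m ≤ B := hU.upper J.succ
  have hZsp : ∀ j, J.succ ≤ j → ∀ m, Z m - (((J : ℕ) : ℤ) + 1) ≤ U j m - ((j : ℕ) : ℤ) :=
    fun j hj m => by simpa using hU.spaced J.succ j hj m
  have hG : ∀ m, 1 ≤ (Z - W) m := by
    intro m
    have h1 : W m - ((J : ℕ) : ℤ) ≤ Z m - (((J : ℕ) : ℤ) + 1) := by
      simpa using hU.spaced J.castSucc J.succ Fin.castSucc_lt_succ.le m
    rw [Pi.sub_apply]; omega
  by_contra! hlt
  have hlt' : p * (Z - W) l < (Z - W) (l - 1) := by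
    simp only [stepVec, Pi.sub_apply] at hlt ⊢; linarith
  have hGl := hG l
  obtain ⟨c, hc1, hc2, hc3⟩ := exists_geometric (n := n) (by omega : 1 ≤ p) (l - 1)
    (x := (Z - W) (l - 1) - 1) (by linarith [hG (l - 1)])
  rw [sub_add_cancel] at hc2
  set H : ZMod n → ℤ := fun m => max 0 ((Z - W) m - c m) with hH
  have hH0 : ∀ m, 0 ≤ H m := fun m => le_max_left _ _
  have hHle : ∀ m, H m ≤ (Z - W) m - 1 := by
    intro m
    refine max_le (by linarith [hG m]) ?_
    have := hc3 m
    nlinarith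
  have hHl : H l = 0 := by
    refine max_eq_left ?_
    have := hc3 l
    nlinarith
  have hHl' : H (l - 1) = 1 := by simp [hH, hc1]
  have hex := energy_exchange hp hpos (U := W) (W := Z) (H := H) fun m => by
    rcases eq_or_ne m l with rfl | hm
    · right
      simp only [stepVec, hHl, hHl']
      constructor <;> linarith
    · have h1 := hc2 m hm
      simp only [stepVec, hH]
      have hp0 : (0 : ℤ) ≤ p := by positivity
      generalize hE : (Z - W) m - c m = E
      generalize hE' : (Z - W) (m - 1) - c (m - 1) = E'
      have h2 : p * (Z - W) m - (Z - W) (m - 1) = p * E - E' := by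
        rw [← hE, ← hE', h1]; ring
      rw [h2]
      rcases le_total 0 E with ha | ha <;> rcases le_total 0 E' with hb | hb
      · rw [max_eq_right ha, max_eq_right hb]; omega
      · rw [max_eq_right ha, max_eq_left hb]
        have := mul_nonneg hp0 ha
        omega
      · rw [max_eq_left ha, max_eq_right hb]
        have := mul_nonpos_of_nonneg_of_nonpos hp0 ha
        rw [mul_zero]; omega
      · rw [max_eq_left ha, max_eq_left hb]
        have := mul_nonpos_of_nonneg_of_nonpos hp0 ha
        rw [mul_zero]; omega
  simp only [Pi.sub_apply] at hHle hG
  have hWle : energy p pos W ≤ energy p pos (W + H) := by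
    refine hU.energy_le hp hpos (fun m => ?_) (fun j hj m => ?_) fun m => ?_
    · exact (hWlow m).trans (le_add_of_nonneg_right (hH0 m))
    · have h1 := hZsp j (Fin.castSucc_lt_iff_succ_le.1 hj) m
      have h2 := hHle m
      rw [Fin.val_castSucc, Pi.add_apply]
      omega
    · have h1 := hZup m
      have h2 := hHle m
      rw [Pi.add_apply]
      omega
  have hZle : energy p pos Z ≤ energy p pos (Z - H) := by
    refine hU.energy_le hp hpos (fun m => ?_) (fun j hj m => ?_) fun m => ?_
    · have h1 := hWlow m
      have h2 := hHle m
      rw [Fin.val_succ, Nat.cast_add, Nat.cast_one, Pi.sub_apply]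
      omega
    · have h1 := hZsp j hj.le m
      have h2 := hH0 m
      rw [Fin.val_succ, Nat.cast_add, Nat.cast_one, Pi.sub_apply]
      omega
    · have h1 := hZup m
      have h2 := hH0 m
      rw [Pi.sub_apply]
      omega
  have heq := energy_injective hp hpos (le_antisymm (by linarith : energy p pos (W + H) ≤ _) hWle)
  have := congrFun heq (l - 1)
  rw [Pi.add_apply, hHl'] at this
  omega

theorem IsOptimalChain.monotone_stepVec (hp : 2 ≤ p) (hpos : IsPositionSystem p pos)
    (hU : IsOptimalChain p pos e B U) (l : ZMod n) : Monotone fun j => stepVec p (U j) l :=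
  Fin.monotone_iff_le_succ.2 fun J => hU.stepVec_le_succ hp hpos J l

theorem IsOptimalChain.apply_zero (hp : 2 ≤ p) (hpos : IsPositionSystem p pos)
    (hneg : ∀ l i, pos l i < 0 ↔ i ≤ 0) (hU : IsOptimalChain p pos e B U) : U 0 = 0 := by
  have hp2 : (2 : ℤ) ≤ p := by exact_mod_cast hp
  have h0 : ∀ l, 0 ≤ U 0 l := fun l => by simpa using hU.lower 0 l
  have hle : energy p pos (U 0) ≤ energy p pos 0 := by
    refine hU.energy_le hp hpos (by simp) (fun j _ l => ?_) fun l => (h0 l).trans (hU.upper 0 l)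
    have := hU.lower j l
    simpa using this
  by_contra hne
  obtain ⟨m, hm⟩ := Function.ne_iff.1 hne
  have hpossum : 0 < ∑ l, U 0 l :=
    Finset.sum_pos' (fun l _ => h0 l) ⟨m, Finset.mem_univ m, lt_of_le_of_ne (h0 m) (Ne.symm hm)⟩
  obtain ⟨l, -, hl⟩ : ∃ l ∈ Finset.univ, 0 < stepVec p (U 0) l := by
    refine Finset.exists_lt_of_sum_lt (f := fun _ => 0) ?_
    rw [sum_stepVec, Finset.sum_const_zero]
    nlinarith
  have hz : ∀ l : ZMod n, stepVec p (0 : ZMod n → ℤ) l = 0 := fun l => by simp [stepVec]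
  rcases sum_cumWeight_lt_or_lt hp hpos (fun h => hne (stepVec_injective hp h)) with h | h
  · exact hle.not_gt h.1
  · obtain ⟨-, c, -, h⟩ := h
    have h1 := h l (by rwa [hz])
    have h2 := (hneg c _).2 (hz c).le
    have h3 := (hneg l _).1 (h1.trans h2)
    omega

theorem IsOptimalChain.stepVec_last_le (hp : 2 ≤ p) (hpos : IsPositionSystem p pos)
    {N : ℤ} {s : ZMod n → ℤ} (hs : ∀ l i, pos l i < N ↔ i ≤ s l)
    (hU : IsOptimalChain p pos e B U) (hU' : IsSpacedChain e B U')
    (hle : ∀ l, stepVec p (U' (Fin.last e)) l ≤ s l) (l : ZMod n) :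
    stepVec p (U (Fin.last e)) l ≤ s l := by
  have h1 : energy p pos (U (Fin.last e)) ≤ energy p pos (U' (Fin.last e)) :=
    hU.energy_le hp hpos (hU'.lower _) (fun j hj => absurd hj (Fin.le_last j).not_gt)
      (hU'.upper _)
  by_contra! hlt
  rcases sum_cumWeight_lt_or_lt hp hpos (fun h => (hlt.trans_le' (hle l)).ne' (congrFun h l))
    with h | h
  · exact h1.not_gt h.1
  · obtain ⟨-, c, -, h⟩ := h
    have h2 := h l ((hle l).trans_lt hlt)
    have h3 := (hs c _).2 (hle c)
    have h4 := (hs l _).1 (h2.trans h3)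
    omega

end

/-- An indexing of a finite family of digit positions `π`: within each residue class modulo `n`
the family is sorted, and `pos` extends the resulting enumeration to all of `ℤ`. -/
structure IsDigitIndexing {I : Type*} (p n : ℕ) (π : I → ℕ) (pos : ZMod n → ℤ → ℤ) (idx : I → ℤ)
    (s : ZMod n → ℤ) (N : ℤ) : Prop extends IsPositionSystem p pos where
  neg_iff : ∀ l i, pos l i < 0 ↔ i ≤ 0
  lt_iff : ∀ l i, pos l i < N ↔ i ≤ s l
  pos_idx : ∀ x, pos (π x) (idx x) = π x
  bound_nonneg : ∀ l, 0 ≤ s l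
  idx_pos : ∀ x, 0 < idx x
  idx_le : ∀ x, idx x ≤ s (π x)
  idx_inj : ∀ x y, (π x : ZMod n) = π y → idx x = idx y → x = y
  idx_surj : ∀ l i, 0 < i → i ≤ s l → ∃ x, (π x : ZMod n) = l ∧ idx x = i

theorem exists_isDigitIndexing {I : Type*} [Fintype I] {p : ℕ} (n : ℕ) [NeZero n] (hp : 2 ≤ p)
    (π : I → ℕ) (hπ : ∀ t, (Finset.univ.filter fun x => π x = t).card ≤ p - 1) :
    ∃ pos idx s N, IsDigitIndexing p n π pos idx s N := by
  classical
  have hn : (1 : ℤ) ≤ n := by exact_mod_cast NeZero.one_le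
  have hσ : ∀ l : ZMod n, ∃ (v : ℕ) (σ : Fin v ≃ {x : I // (π x : ZMod n) = l}),
      Monotone fun i => π (σ i) := fun l =>
    ⟨_, (Tuple.sort fun i => π ((Fintype.equivFin {x : I // (π x : ZMod n) = l}).symm i)).trans
      (Fintype.equivFin _).symm,
      Tuple.monotone_sort fun i => π ((Fintype.equivFin {x : I // (π x : ZMod n) = l}).symm i)⟩
  choose v σ hmono using hσ
  obtain ⟨N, hN⟩ : ∃ N : ℕ, ∀ x, π x < N :=
    ⟨∑ x, π x + 1, fun x => Nat.lt_succ_of_le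
      (Finset.single_le_sum (f := π) (fun _ _ => Nat.zero_le _) (Finset.mem_univ x))⟩
  set pos : ZMod n → ℤ → ℤ := fun l i =>
    if h : 0 < i ∧ i ≤ v l then (π (σ l ⟨(i - 1).toNat, by omega⟩) : ℤ)
    else if i ≤ 0 then l.val + n * (i - 1) else l.val + n * (N + i) with hpos
  have hmid : ∀ (l : ZMod n) (i : ℤ) (h : 0 < i ∧ i ≤ v l),
      pos l i = π (σ l ⟨(i - 1).toNat, by omega⟩) :=
    fun l i h => dif_pos h
  have hlow : ∀ (l : ZMod n) (i : ℤ), i ≤ 0 → pos l i = l.val + n * (i - 1) := fun l i h => by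
    simp only [hpos]
    rw [dif_neg (by omega), if_pos h]
  have hhigh : ∀ (l : ZMod n) (i : ℤ), 0 < i → v l < i →
      pos l i = l.val + n * (N + i) := fun l i h h' => by
    simp only [hpos]
    rw [dif_neg (by omega), if_neg (by omega)]
  have hlneg : ∀ (l : ZMod n) (i : ℤ), i ≤ 0 → pos l i < 0 := by
    intro l i h
    rw [hlow l i h]
    have : (l.val : ℤ) < n := by exact_mod_cast l.val_lt
    nlinarith
  have hhN : ∀ (l : ZMod n) (i : ℤ), 0 < i → v l < i → N ≤ pos l i := by
    intro l i h h'
    rw [hhigh l i h h']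
    have : (0 : ℤ) ≤ l.val := by positivity
    nlinarith
  have hmN : ∀ (l : ZMod n) (i : ℤ), 0 < i ∧ i ≤ v l → 0 ≤ pos l i ∧ pos l i < N := by
    intro l i h
    rw [hmid l i h]
    exact ⟨by positivity, by exact_mod_cast hN _⟩
  have hcast : ∀ l i, ((pos l i : ℤ) : ZMod n) = l := by
    intro l i
    rcases le_or_gt i 0 with h | h
    · rw [hlow l i h]; simp
    · rcases le_or_gt i (v l) with h' | h'
      · rw [hmid l i ⟨h, h'⟩, Int.cast_natCast]
        exact (σ l _).2
      · rw [hhigh l i h h']; simp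
  have hsucc : ∀ l, Monotone (pos l) := by
    intro l
    refine monotone_int_of_le_succ fun i => ?_
    rcases lt_trichotomy i 0 with h | rfl | h
    · rw [hlow l i h.le, hlow l (i + 1) (by omega)]
      nlinarith
    · refine (hlneg l 0 le_rfl).le.trans ?_
      rcases le_or_gt (0 + 1) (v l : ℤ) with h' | h'
      · exact (hmN l _ ⟨by omega, h'⟩).1
      · exact le_trans (Int.natCast_nonneg N) (hhN l _ (by omega) h')
    · rcases lt_trichotomy i (v l) with h' | h' | h'
      · rw [hmid l i ⟨h, by omega⟩, hmid l (i + 1) ⟨by omega, by omega⟩]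
        exact_mod_cast hmono l (Fin.mk_le_mk.2 (by omega))
      · exact (hmN l i ⟨h, h'.le⟩).2.le.trans (hhN l _ (by omega) (by omega))
      · rw [hhigh l i h h', hhigh l (i + 1) (by omega) (by omega)]
        nlinarith
  refine ⟨pos, fun x => ((σ (π x)).symm ⟨x, rfl⟩ : ℕ) + 1, fun l => v l, N,
    ⟨⟨hsucc, fun l i => ?_, fun l l' i i' h => ?_⟩, fun l i => ⟨fun h => ?_, hlneg l i⟩,
      fun l i => ⟨fun h => ?_, fun h => ?_⟩, fun x => ?_, fun l => Int.natCast_nonneg _,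
      fun x => ?_, fun x => ?_,
      fun x y hxy h => ?_, fun l i h h' => ?_⟩⟩
  · have hp' : (2 : ℤ) ≤ p := by exact_mod_cast hp
    rcases le_or_gt i 0 with h | h
    · rcases le_or_gt (i + (p - 1)) 0 with h' | h'
      · rw [hlow l i h, hlow l _ h']
        nlinarith
      · refine (hlneg l i h).trans_le ?_
        rcases le_or_gt (i + (p - 1)) (v l : ℤ) with h'' | h''
        · exact (hmN l _ ⟨h', h''⟩).1
        · exact le_trans (Int.natCast_nonneg N) (hhN l _ h' h'')
    · rcases le_or_gt i (v l) with h1 | h1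
      · rcases le_or_gt (i + (p - 1)) (v l : ℤ) with h' | h'
        · refine lt_of_le_of_ne (hsucc l (by omega)) fun heq => ?_
          have hcard : (Finset.Icc i (i + (p - 1))).card ≤
              (Finset.univ.filter fun x => (π x : ℤ) = pos l i).card := by
            refine Finset.card_le_card_of_injOn
              (fun j => if h : 0 < j ∧ j ≤ v l then (σ l ⟨(j - 1).toNat, by omega⟩ : I)
                else (σ l ⟨(i - 1).toNat, by omega⟩ : I)) ?_ ?_
            · intro j hj
              rw [Finset.mem_coe, Finset.mem_Icc] at hj
              have hj' : 0 < j ∧ j ≤ v l := by omega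
              simp only [dif_pos hj', Finset.coe_filter, Finset.mem_univ, true_and,
                Set.mem_ofPred_eq]
              rw [← hmid l j hj']
              exact le_antisymm ((hsucc l hj.2).trans heq.ge) (hsucc l hj.1)
            · intro j hj j' hj' h
              rw [Finset.mem_coe, Finset.mem_Icc] at hj hj'
              have h2 : 0 < j ∧ j ≤ v l := by omega
              have h2' : 0 < j' ∧ j' ≤ v l := by omega
              simp only [dif_pos h2, dif_pos h2'] at h
              have h3 := (σ l).injective (Subtype.ext h)
              rw [Fin.mk.injEq] at h3
              omega
          rw [hmid l i ⟨h, h1⟩] at hcard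
          simp only [Nat.cast_inj] at hcard
          have := hcard.trans (hπ _)
          rw [Int.card_Icc] at this
          omega
        · exact (hmN l i ⟨h, h1⟩).2.trans_le (hhN l _ (by omega) h')
      · rw [hhigh l i h h1, hhigh l _ (by omega) (by omega)]
        nlinarith
  · rw [← hcast l i, h, hcast]
  · by_contra! hi
    rcases le_or_gt i (v l) with h1 | h1
    · exact absurd h (hmN l i ⟨hi, h1⟩).1.not_gt
    · exact absurd h (le_trans (Int.natCast_nonneg N) (hhN l i hi h1)).not_gt
  · by_contra! hi
    exact absurd h (hhN l i (by omega) hi).not_gt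
  · rcases le_or_gt i 0 with h1 | h1
    · exact (hlneg l i h1).trans_le (by positivity)
    · exact (hmN l i ⟨h1, h⟩).2
  · have h := ((σ (π x)).symm ⟨x, rfl⟩).2
    rw [hmid _ _ ⟨by omega, by omega⟩]
    simp
  · positivity
  · have h := ((σ (π x)).symm ⟨x, rfl⟩).2
    omega
  · have key : ∀ (l l' : ZMod n) (a : {x : I // (π x : ZMod n) = l})
        (b : {x : I // (π x : ZMod n) = l'}), l = l' →
        (((σ l).symm a : ℕ) : ℤ) + 1 = (((σ l').symm b : ℕ) : ℤ) + 1 → (a : I) = b := by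
      rintro l _ a b rfl hab
      have h1 : (σ l).symm a = (σ l).symm b := Fin.ext (by omega)
      rw [(σ l).symm.injective h1]
    exact key _ _ ⟨x, rfl⟩ ⟨y, rfl⟩ hxy h
  · refine ⟨σ l ⟨(i - 1).toNat, by omega⟩, (σ l _).2, ?_⟩
    have key : ∀ (l' : ZMod n) (a : {x : I // (π x : ZMod n) = l})
        (b : {x : I // (π x : ZMod n) = l'}), l = l' → (a : I) = b →
        ((σ l).symm a : ℕ) = ((σ l').symm b : ℕ) := by
      rintro _ a b rfl hab
      rw [Subtype.ext hab]
    rw [← key _ _ ⟨_, rfl⟩ (σ l _).2.symm rfl, Equiv.symm_apply_apply]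
    simp only
    omega

section

variable {n p : ℕ} [NeZero n]

theorem exists_stepVec_eq_iff (hp : 2 ≤ p) (V : ZMod n → ℤ) :
    (∃ U, stepVec p U = V) ↔ ((p : ℤ) ^ n - 1) ∣ ∑ l, V l * (p : ℤ) ^ l.val := by
  have hn : n ≠ 0 := NeZero.ne n
  have hq : (p : ℤ) ^ n - 1 ≠ 0 := by
    have : (1 : ℤ) < (p : ℤ) ^ n := one_lt_pow₀ (by exact_mod_cast hp) hn
    omega
  constructor
  · rintro ⟨U, rfl⟩
    have h1 : ∑ l, U (l - 1) * (p : ℤ) ^ l.val = ∑ l, U l * (p : ℤ) ^ (l + 1).val := by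
      rw [← Equiv.sum_comp (Equiv.addRight (1 : ZMod n))]
      simp
    have h2 : ∑ l, stepVec p U l * (p : ℤ) ^ l.val =
        ∑ l, U l * ((p : ℤ) ^ (l.val + 1) - (p : ℤ) ^ (l + 1).val) := by
      simp only [stepVec, sub_mul, mul_sub, Finset.sum_sub_distrib, h1]
      congr 1
      exact Finset.sum_congr rfl fun l _ => by ring
    rw [h2]
    refine Finset.dvd_sum fun l _ => Dvd.dvd.mul_left ?_ _
    have h3 : (l + 1).val = (l.val + 1) % n := by rw [ZMod.val_add, ZMod.val_one_eq_one_mod]; simp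
    have h4 : (p : ℤ) ^ (l.val + 1) =
        ((p : ℤ) ^ n) ^ ((l.val + 1) / n) * (p : ℤ) ^ ((l.val + 1) % n) := by
      rw [← pow_mul, ← pow_add, Nat.div_add_mod]
    have h5 : (p : ℤ) ^ n - 1 ∣ ((p : ℤ) ^ n) ^ ((l.val + 1) / n) - 1 := by
      simpa using sub_dvd_pow_sub_pow ((p : ℤ) ^ n) 1 ((l.val + 1) / n)
    rw [h3, h4, show ∀ a b : ℤ, a * b - b = (a - 1) * b by intros; ring]
    exact h5.mul_right _
  · intro h
    set A : ZMod n → ℤ := fun l => ∑ i ∈ Finset.range n, V (l - i) * (p : ℤ) ^ (n - 1 - i) with hA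
    have hrec : ∀ l, p * A l - A (l - 1) = ((p : ℤ) ^ n - 1) * V l := by
      intro l
      obtain ⟨m, rfl⟩ := Nat.exists_eq_succ_of_ne_zero hn
      have h1 : p * A l = ∑ i ∈ Finset.range (m + 1), V (l - i) * (p : ℤ) ^ (m + 1 - i) := by
        simp only [hA, Finset.mul_sum]
        refine Finset.sum_congr rfl fun i hi => ?_
        rw [Finset.mem_range] at hi
        rw [show m + 1 - i = (m.succ - 1 - i) + 1 by omega, pow_succ]
        ring
      have h2 : A (l - 1) = ∑ i ∈ Finset.range (m + 1),
          V (l - (i + 1 : ℕ)) * (p : ℤ) ^ (m + 1 - (i + 1)) := by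
        refine Finset.sum_congr rfl fun i hi => ?_
        rw [show l - 1 - (i : ZMod m.succ) = l - ((i + 1 : ℕ) : ZMod m.succ) by push_cast; ring,
          show m.succ - 1 - i = m + 1 - (i + 1) by omega]
      have h3 := Finset.sum_range_succ (fun i : ℕ => V (l - i) * (p : ℤ) ^ (m + 1 - i)) (m + 1)
      have h4 := Finset.sum_range_succ' (fun i : ℕ => V (l - i) * (p : ℤ) ^ (m + 1 - i)) (m + 1)
      have h5 : ((m + 1 : ℕ) : ZMod m.succ) = 0 := ZMod.natCast_self _
      rw [← h2] at h4
      rw [← h1, h4] at h3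
      rw [h5] at h3
      simp only [Nat.cast_zero, sub_zero, Nat.sub_self, pow_zero, mul_one] at h3
      linear_combination -h3
    have hlast : A (-1) = ∑ l, V l * (p : ℤ) ^ l.val := by
      simp only [hA]
      rw [← Finset.sum_range_reflect]
      refine Finset.sum_bij' (fun i _ => (i : ZMod n)) (fun l _ => l.val) (by simp)
        (fun l _ => Finset.mem_range.2 l.val_lt) (fun i hi => ?_) (by simp) fun i hi => ?_
      · exact ZMod.val_cast_of_lt (Finset.mem_range.1 hi)
      · rw [Finset.mem_range] at hi
        rw [ZMod.val_cast_of_lt hi, show n - 1 - (n - 1 - i) = i by omega]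
        congr 2
        have : ((n - 1 - i : ℕ) : ZMod n) + i + 1 = 0 := by
          rw [← Nat.cast_add, ← Nat.cast_add_one, show n - 1 - i + i + 1 = n by omega]
          simp
        linear_combination -this
    have hdvd : ∀ k : ℕ, ((p : ℤ) ^ n - 1) ∣ A (-1 - k) := by
      intro k
      induction k with
      | zero => simpa [hlast] using h
      | succ k ih =>
        have h1 := hrec (-1 - k)
        rw [show (-1 - (k : ZMod n) - 1) = -1 - ((k + 1 : ℕ) : ZMod n) by push_cast; ring] at h1
        rw [show A (-1 - ((k + 1 : ℕ) : ZMod n)) =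
          p * A (-1 - k) - ((p : ℤ) ^ n - 1) * V (-1 - k) by linarith]
        exact dvd_sub (ih.mul_left _) (dvd_mul_right _ _)
    have hdvd' : ∀ l, ((p : ℤ) ^ n - 1) ∣ A l := by
      intro l
      have := hdvd (-1 - l).val
      rwa [ZMod.natCast_zmod_val, sub_sub_cancel] at this
    choose U hU using hdvd'
    refine ⟨U, funext fun l => mul_left_cancel₀ hq ?_⟩
    rw [← hrec l, hU l, hU (l - 1), stepVec]
    ring

end

section

variable {I : Type*} [Fintype I] {e : ℕ} (p n : ℕ) (π : I → ℕ) (φ : I → Fin (e + 1))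

/-- The assignments of digits to coefficients that contribute to the power sum. -/
def IsValidAssignment : Prop :=
  ∀ j : Fin e, 0 < ∑ x with φ x = j.castSucc, p ^ π x ∧
    (p ^ n - 1) ∣ ∑ x with φ x = j.castSucc, p ^ π x

/-- The total weight of the digits assigned to indices less than `j`. -/
def partialWeight (j : Fin (e + 1)) : ℕ := ∑ x with φ x < j, p ^ π x

/-- The number of digits of a given residue class assigned to indices less than `j`. -/
def classCount (j : Fin (e + 1)) (l : ZMod n) : ℤ :=
  (Finset.univ.filter fun x => φ x < j ∧ (π x : ZMod n) = l).card

variable {p n π φ}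

theorem partialWeight_succ (j : Fin e) :
    partialWeight p π φ j.succ =
      partialWeight p π φ j.castSucc + ∑ x with φ x = j.castSucc, p ^ π x := by
  simp only [partialWeight, Finset.sum_filter, ← Finset.sum_add_distrib]
  refine Finset.sum_congr rfl fun x _ => ?_
  rcases lt_trichotomy (φ x) j.castSucc with h | h | h
  · rw [if_pos (h.trans Fin.castSucc_lt_succ), if_pos h, if_neg h.ne, add_zero]
  · rw [if_pos (h ▸ Fin.castSucc_lt_succ), if_neg h.not_lt, if_pos h, zero_add]
  · rw [if_neg (Fin.castSucc_lt_iff_succ_le.1 h).not_gt, if_neg h.not_gt, if_neg h.ne',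
      add_zero]

theorem isValidAssignment_iff (hp : 2 ≤ p) : IsValidAssignment p n π φ ↔
    (∀ j : Fin e, ∃ x, φ x = j.castSucc) ∧ ∀ j, (p ^ n - 1) ∣ partialWeight p π φ j := by
  have hpos : ∀ j : Fin e, 0 < ∑ x with φ x = j.castSucc, p ^ π x ↔ ∃ x, φ x = j.castSucc := by
    intro j
    constructor
    · intro h
      by_contra! hcon
      rw [Finset.filter_false_of_mem fun x _ => hcon x] at h
      simp at h
    · rintro ⟨x, hx⟩
      exact Finset.sum_pos (fun _ _ => by positivity) ⟨x, by simpa using hx⟩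
  constructor
  · intro h
    refine ⟨fun j => (hpos j).1 (h j).1, fun j => ?_⟩
    induction j using Fin.induction with
    | zero => simp [partialWeight]
    | succ j ih => rw [partialWeight_succ]; exact dvd_add ih (h j).2
  · rintro ⟨h1, h2⟩ j
    refine ⟨(hpos j).2 (h1 j), ?_⟩
    have := h2 j.succ
    rwa [partialWeight_succ, Nat.dvd_add_right (h2 _)] at this

variable [NeZero n]

theorem dvd_partialWeight_iff (hp : 2 ≤ p) (j : Fin (e + 1)) :
    (p ^ n - 1) ∣ partialWeight p π φ j ↔ ∃ U, stepVec p U = classCount n π φ j := by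
  rw [exists_stepVec_eq_iff hp]
  have h1 : ((p ^ n - 1 : ℕ) : ℤ) = (p : ℤ) ^ n - 1 := by
    rw [Nat.cast_sub (Nat.one_le_pow _ _ (by omega))]; simp
  have h2 : ∑ l, classCount n π φ j l * (p : ℤ) ^ l.val =
      ∑ x with φ x < j, (p : ℤ) ^ (π x : ZMod n).val := by
    rw [← Finset.sum_fiberwise (Finset.univ.filter fun x => φ x < j) (fun x => (π x : ZMod n))]
    refine Finset.sum_congr rfl fun l _ => ?_
    rw [Finset.filter_filter, Finset.sum_congr rfl (g := fun _ => (p : ℤ) ^ l.val)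
      (fun x hx => by rw [(Finset.mem_filter.1 hx).2.2]), Finset.sum_const, nsmul_eq_mul]
    simp [classCount]
  have h3 : (p : ℤ) ^ n - 1 ∣ (partialWeight p π φ j : ℤ) -
      ∑ l, classCount n π φ j l * (p : ℤ) ^ l.val := by
    rw [h2, partialWeight, Nat.cast_sum, ← Finset.sum_sub_distrib]
    refine Finset.dvd_sum fun x _ => ?_
    rw [ZMod.val_natCast, Nat.cast_pow]
    have h4 : (p : ℤ) ^ π x = ((p : ℤ) ^ n) ^ (π x / n) * (p : ℤ) ^ (π x % n) := by
      rw [← pow_mul, ← pow_add, Nat.div_add_mod]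
    have h5 : (p : ℤ) ^ n - 1 ∣ ((p : ℤ) ^ n) ^ (π x / n) - 1 := by
      simpa using sub_dvd_pow_sub_pow ((p : ℤ) ^ n) 1 (π x / n)
    nth_rewrite 1 [h4]
    rw [show ∀ a b : ℤ, a * b - b = (a - 1) * b by intros; ring]
    exact h5.mul_right _
  rw [← Int.natCast_dvd_natCast, h1]
  exact dvd_iff_dvd_of_dvd_sub h3

theorem IsValidAssignment.exists_isSpacedChain (hp : 2 ≤ p) (h : IsValidAssignment p n π φ) :
    ∃ U : Fin (e + 1) → ZMod n → ℤ, IsSpacedChain e (Fintype.card I) U ∧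
      ∀ j, stepVec p (U j) = classCount n π φ j := by
  obtain ⟨h1, h2⟩ := (isValidAssignment_iff hp).1 h
  choose U hU using fun j => (dvd_partialWeight_iff hp j).1 (h2 j)
  have hp2 : (2 : ℤ) ≤ p := by exact_mod_cast hp
  have h0 : U 0 = 0 := by
    refine stepVec_injective hp ?_
    rw [hU]
    funext l
    simp [classCount, stepVec]
  have hstep : ∀ (j : Fin e) l, 1 ≤ (U j.succ - U j.castSucc) l := by
    intro j
    refine one_le_of_stepVec_nonneg hp (fun l => ?_) ?_
    · rw [stepVec_sub, hU, hU, sub_nonneg]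
      simp only [classCount, Nat.cast_le]
      refine Finset.card_le_card fun x hx => ?_
      simp only [Finset.mem_filter, Finset.mem_univ, true_and] at hx ⊢
      exact ⟨hx.1.trans Fin.castSucc_lt_succ, hx.2⟩
    · intro hzero
      obtain ⟨x, hx⟩ := h1 j
      have h3 : classCount n π φ j.succ = classCount n π φ j.castSucc := by
        rw [← hU, ← hU, sub_eq_zero.1 hzero]
      have h4 := congrFun h3 (π x)
      simp only [classCount, Nat.cast_inj] at h4
      refine (Finset.card_lt_card ?_).ne' h4
      refine (Finset.ssubset_iff_of_subset fun y hy => ?_).2 ⟨x, ?_, ?_⟩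
      · simp only [Finset.mem_filter, Finset.mem_univ, true_and] at hy ⊢
        exact ⟨hy.1.trans Fin.castSucc_lt_succ, hy.2⟩
      · simp [hx]
      · simp [hx]
  have hmono : ∀ l, Monotone fun j : Fin (e + 1) => U j l - ((j : ℕ) : ℤ) := by
    intro l
    refine Fin.monotone_iff_le_succ.2 fun j => ?_
    have := hstep j l
    simp only [Pi.sub_apply, Fin.val_castSucc, Fin.val_succ, Nat.cast_add, Nat.cast_one] at this ⊢
    omega
  have hlow : ∀ (j : Fin (e + 1)) l, ((j : ℕ) : ℤ) ≤ U j l := by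
    intro j l
    have := hmono l (Fin.zero_le j)
    simp only [h0, Pi.zero_apply, Fin.val_zero, Nat.cast_zero, sub_zero, sub_nonneg] at this
    exact this
  refine ⟨U, ⟨hlow, fun i j hij l => hmono l hij, fun j l => ?_⟩, hU⟩
  have hnn : ∀ l, 0 ≤ U j l := fun l => (Int.natCast_nonneg _).trans (hlow j l)
  have h3 : U j l ≤ ∑ l, U j l :=
    Finset.single_le_sum (f := U j) (fun l _ => hnn l) (Finset.mem_univ l)
  have h4 := sum_stepVec (p := p) (U j)
  have h5 : ∑ l, stepVec p (U j) l ≤ Fintype.card I := by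
    rw [hU]
    simp only [classCount, ← Finset.filter_filter]
    rw [← Nat.cast_sum, Finset.sum_card_fiberwise_eq_card_filter]
    simp only [Finset.mem_univ, Finset.filter_true]
    exact_mod_cast Finset.card_le_univ _
  nlinarith

end

theorem cumWeight_card_le {p : ℕ} (hp : 1 ≤ p) {g : ℤ → ℤ} (hg : Monotone g) (A : Finset ℤ)
    (hA : ∀ a ∈ A, 0 < a) : cumWeight p g A.card ≤ ∑ a ∈ A, (p : ℚ) ^ g a := by
  induction A using Finset.induction_on_max with
  | empty => simp [cumWeight]
  | insert a A hlt ih =>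
    have ha : a ∉ A := fun h => lt_irrefl _ (hlt a h)
    have h1 := ih fun b hb => hA b (Finset.mem_insert_of_mem hb)
    have h2 : (A.card : ℤ) + 1 ≤ a := by
      have h3 : insert a A ⊆ Finset.Ioc 0 a := fun b hb => Finset.mem_Ioc.2 ⟨hA b hb, by
        rcases Finset.mem_insert.1 hb with rfl | hb
        · exact le_rfl
        · exact (hlt b hb).le⟩
      have h4 := Finset.card_le_card h3
      have h5 := hA a (Finset.mem_insert_self _ _)
      rw [Finset.card_insert_of_notMem ha, Int.card_Ioc] at h4
      omega
    have h3 : (p : ℚ) ^ g (A.card + 1) ≤ (p : ℚ) ^ g a :=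
      zpow_le_zpow_right₀ (by exact_mod_cast hp) (hg h2)
    rw [Finset.card_insert_of_notMem ha, Finset.sum_insert ha, Nat.cast_add, Nat.cast_one,
      cumWeight_add_one]
    linarith

section

variable {I : Type*} [Fintype I] {e p n : ℕ} {π : I → ℕ} {φ φ' : I → Fin (e + 1)}
  {pos : ZMod n → ℤ → ℤ} {idx : I → ℤ} {s : ZMod n → ℤ} {N : ℤ}

namespace IsDigitIndexing

theorem card_image (h : IsDigitIndexing p n π pos idx s N) (j : Fin (e + 1)) (l : ZMod n) :
    (((Finset.univ.filter fun x => φ x < j ∧ (π x : ZMod n) = l).image idx).card : ℤ) =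
      classCount n π φ j l := by
  rw [classCount, Finset.card_image_of_injOn]
  intro x hx y hy hxy
  simp only [Finset.coe_filter, Finset.mem_univ, true_and, Set.mem_ofPred_eq] at hx hy
  exact h.idx_inj x y (hx.2.trans hy.2.symm) hxy

theorem classCount_le (h : IsDigitIndexing p n π pos idx s N) (j : Fin (e + 1)) (l : ZMod n) :
    classCount n π φ j l ≤ s l := by
  rw [← h.card_image]
  have h1 : (Finset.univ.filter fun x => φ x < j ∧ (π x : ZMod n) = l).image idx ⊆
      Finset.Ioc 0 (s l) := by
    intro a ha
    simp only [Finset.mem_image, Finset.mem_filter, Finset.mem_univ, true_and] at ha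
    obtain ⟨x, ⟨-, rfl⟩, rfl⟩ := ha
    exact Finset.mem_Ioc.2 ⟨h.idx_pos x, h.idx_le x⟩
  have h2 := Finset.card_le_card h1
  have h3 := h.bound_nonneg l
  rw [Int.card_Ioc] at h2
  omega

variable [NeZero n]

theorem partialWeight_eq (h : IsDigitIndexing p n π pos idx s N) (j : Fin (e + 1)) :
    (partialWeight p π φ j : ℚ) =
      ∑ l, ∑ a ∈ (Finset.univ.filter fun x => φ x < j ∧ (π x : ZMod n) = l).image idx,
        (p : ℚ) ^ pos l a := by
  rw [partialWeight, Nat.cast_sum,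
    ← Finset.sum_fiberwise (Finset.univ.filter fun x => φ x < j) (fun x => (π x : ZMod n))]
  refine Finset.sum_congr rfl fun l _ => ?_
  rw [Finset.filter_filter, Finset.sum_image]
  · refine Finset.sum_congr rfl fun x hx => ?_
    have h1 := h.pos_idx x
    rw [(Finset.mem_filter.1 hx).2.2] at h1
    rw [h1, zpow_natCast, Nat.cast_pow]
  · intro x hx y hy hxy
    simp only [Finset.coe_filter, Finset.mem_univ, true_and, Set.mem_ofPred_eq] at hx hy
    exact h.idx_inj x y (hx.2.trans hy.2.symm) hxy

theorem energy_le_partialWeight (hp : 2 ≤ p) (h : IsDigitIndexing p n π pos idx s N)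
    {j : Fin (e + 1)} {U : ZMod n → ℤ} (hU : stepVec p U = classCount n π φ j) :
    energy p pos U ≤ partialWeight p π φ j := by
  rw [h.partialWeight_eq, energy]
  refine Finset.sum_le_sum fun l _ => ?_
  rw [hU, ← h.card_image]
  refine cumWeight_card_le (by omega) (h.mono l) _ fun a ha => ?_
  obtain ⟨x, -, rfl⟩ := Finset.mem_image.1 ha
  exact h.idx_pos x

theorem exists_isValidAssignment (hp : 2 ≤ p) (h : IsDigitIndexing p n π pos idx s N) {B : ℤ}
    {U : Fin (e + 1) → ZMod n → ℤ} (hU : IsSpacedChain e B U) (h0 : U 0 = 0)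
    (hmono : ∀ l, Monotone fun j => stepVec p (U j) l)
    (hlast : ∀ l, stepVec p (U (Fin.last e)) l ≤ s l) :
    ∃ φ : I → Fin (e + 1), IsValidAssignment p n π φ ∧
      ∀ j, (partialWeight p π φ j : ℚ) = energy p pos (U j) := by
  have hV0 : ∀ l, stepVec p (U 0) l = 0 := fun l => by simp [h0, stepVec]
  have hex : ∀ x, ∃ m : Fin (e + 1), ∀ j, j ≤ m ↔ stepVec p (U j) (π x) < idx x := by
    intro x
    set S := Finset.univ.filter fun j => stepVec p (U j) (π x) < idx x with hS
    have hne : S.Nonempty := ⟨0, by simp [hS, hV0, h.idx_pos]⟩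
    refine ⟨S.max' hne, fun j => ⟨fun hj => ?_, fun hj => ?_⟩⟩
    · have h1 := S.max'_mem hne
      simp only [hS, Finset.mem_filter, Finset.mem_univ, true_and] at h1
      exact (hmono _ hj).trans_lt h1
    · exact S.le_max' j (by simpa [hS] using hj)
  choose φ hφ using hex
  have hφ' : ∀ x j, φ x < j ↔ idx x ≤ stepVec p (U j) (π x) := fun x j => by
    rw [← not_le, hφ, not_lt]
  have himage : ∀ j l, (Finset.univ.filter fun x => φ x < j ∧ (π x : ZMod n) = l).image idx =
      Finset.Ioc 0 (stepVec p (U j) l) := by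
    intro j l
    ext a
    simp only [Finset.mem_image, Finset.mem_filter, Finset.mem_univ, true_and, Finset.mem_Ioc]
    constructor
    · rintro ⟨x, ⟨hx, rfl⟩, rfl⟩
      exact ⟨h.idx_pos x, (hφ' x j).1 hx⟩
    · rintro ⟨h1, h2⟩
      obtain ⟨x, rfl, rfl⟩ :=
        h.idx_surj l a h1 (h2.trans ((hmono l (Fin.le_last j)).trans (hlast l)))
      exact ⟨x, ⟨(hφ' x j).2 h2, rfl⟩, rfl⟩
  have hVnn : ∀ j l, 0 ≤ stepVec p (U j) l := fun j l => by
    rw [← hV0 l]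
    exact hmono l (Fin.zero_le j)
  have hcount : ∀ j, stepVec p (U j) = classCount n π φ j := by
    intro j
    funext l
    rw [← h.card_image, himage, Int.card_Ioc, sub_zero, Int.toNat_of_nonneg (hVnn j l)]
  refine ⟨φ, (isValidAssignment_iff hp).2 ⟨fun j => ?_, fun j => ?_⟩, fun j => ?_⟩
  · by_contra! hcon
    have h1 : U j.castSucc = U j.succ := by
      refine stepVec_injective hp ?_
      rw [hcount, hcount]
      funext l
      have h2 : ∀ x, φ x < j.castSucc ↔ φ x < j.succ := fun x =>
        ⟨fun hx => hx.trans Fin.castSucc_lt_succ,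
          fun hx => lt_of_le_of_ne (Fin.le_castSucc_iff.2 hx) (hcon x)⟩
      simp only [classCount, h2]
    have h2 := hU.spaced _ _ (Fin.castSucc_lt_succ (i := j)).le 0
    rw [h1, Fin.val_castSucc, Fin.val_succ] at h2
    push_cast at h2
    omega
  · exact (dvd_partialWeight_iff hp j).2 ⟨U j, hcount j⟩
  · rw [h.partialWeight_eq, energy]
    refine Finset.sum_congr rfl fun l _ => ?_
    rw [himage, cumWeight, Finset.Ioc_eq_empty (hVnn j l).not_gt]
    simp

end IsDigitIndexing

/-- The assignments of minimal cost among the valid ones. -/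
structure IsMinimalAssignment (p n : ℕ) (π : I → ℕ) (φ : I → Fin (e + 1)) : Prop where
  valid : IsValidAssignment p n π φ
  le : ∀ φ' : I → Fin (e + 1), IsValidAssignment p n π φ' →
    ∑ j, partialWeight p π φ j ≤ ∑ j, partialWeight p π φ' j

variable [NeZero n]

theorem IsMinimalAssignment.partialWeight_eq (hp : 2 ≤ p)
    (h : IsDigitIndexing p n π pos idx s N) (hφ : IsMinimalAssignment p n π φ)
    {U : Fin (e + 1) → ZMod n → ℤ} (hU : IsOptimalChain p pos e (Fintype.card I) U)
    (j : Fin (e + 1)) : (partialWeight p π φ j : ℚ) = energy p pos (U j) := by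
  obtain ⟨W, hW, hWφ⟩ := hφ.valid.exists_isSpacedChain hp
  have hpos := h.toIsPositionSystem
  obtain ⟨φ₀, hφ₀, hcost⟩ := h.exists_isValidAssignment hp hU.toIsSpacedChain
    (hU.apply_zero hp hpos h.neg_iff) (hU.monotone_stepVec hp hpos)
    (hU.stepVec_last_le hp hpos h.lt_iff hW fun l => by
      rw [hWφ]
      exact h.classCount_le _ _)
  have h1 : ∑ j, (partialWeight p π φ j : ℚ) ≤ ∑ j, energy p pos (U j) := by
    simp only [← hcost]
    exact_mod_cast hφ.le φ₀ hφ₀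
  have h2 : ∀ j ∈ Finset.univ, energy p pos (W j) ≤ partialWeight p π φ j :=
    fun j _ => h.energy_le_partialWeight hp (hWφ j)
  have h3 := Finset.sum_le_sum h2
  have hWopt : IsOptimalChain p pos e (Fintype.card I) W :=
    ⟨hW, fun U' hU' => (h3.trans h1).trans (hU.le U' hU')⟩
  obtain rfl := hU.unique hp hpos hWopt
  exact ((Finset.sum_eq_sum_iff_of_le h2).1 (le_antisymm h3 h1) j (Finset.mem_univ j)).symm

theorem IsMinimalAssignment.partialWeight_eq_partialWeight (hp : 2 ≤ p)
    (hπ : ∀ t, (Finset.univ.filter fun x => π x = t).card ≤ p - 1)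
    (hφ : IsMinimalAssignment p n π φ) (hφ' : IsMinimalAssignment p n π φ') (j : Fin (e + 1)) :
    partialWeight p π φ j = partialWeight p π φ' j := by
  obtain ⟨pos, idx, s, N, h⟩ := exists_isDigitIndexing n hp π hπ
  obtain ⟨W, hW, -⟩ := hφ.valid.exists_isSpacedChain hp
  obtain ⟨U, hU⟩ := hW.exists_isOptimalChain (p := p) (pos := pos)
  have := (hφ.partialWeight_eq hp h hU j).trans (hφ'.partialWeight_eq hp h hU j).symm
  exact_mod_cast this

end

theorem eq_of_sum_mul_pow_eq {p : ℕ} {a b : ℕ → ℕ} (ha : ∀ s, a s < p) (hb : ∀ s, b s < p)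
    {m : ℕ} (h : ∑ s ∈ Finset.range m, a s * p ^ s = ∑ s ∈ Finset.range m, b s * p ^ s) :
    ∀ s < m, a s = b s := by
  induction m generalizing a b with
  | zero => simp
  | succ m ih =>
    have key : ∀ c : ℕ → ℕ, ∑ s ∈ Finset.range (m + 1), c s * p ^ s =
        c 0 + p * ∑ s ∈ Finset.range m, c (s + 1) * p ^ s := fun c => by
      rw [Finset.sum_range_succ', Finset.mul_sum, add_comm]
      simp only [pow_zero, mul_one, pow_succ]
      congr 1
      exact Finset.sum_congr rfl fun s _ => by ring
    rw [key, key] at h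
    have h0 : a 0 = b 0 := by
      have := congrArg (· % p) h
      simpa [Nat.add_mul_mod_self_left, Nat.mod_eq_of_lt (ha 0), Nat.mod_eq_of_lt (hb 0)] using this
    rw [h0, add_right_inj] at h
    have h1 := ih (fun s => ha (s + 1)) (fun s => hb (s + 1))
      (Nat.eq_of_mul_eq_mul_left (lt_of_le_of_lt (Nat.zero_le _) (ha 0)) h)
    intro s hs
    cases s with
    | zero => exact h0
    | succ s => exact h1 s (by omega)

section

variable {I : Type*} [Fintype I] {e p n : ℕ} {π : I → ℕ} {φ φ' : I → Fin (e + 1)}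

theorem partialWeight_last_add :
    partialWeight p π φ (Fin.last e) + ∑ x with φ x = Fin.last e, p ^ π x = ∑ x, p ^ π x := by
  rw [← Finset.sum_filter_add_sum_filter_not Finset.univ (fun x => φ x < Fin.last e)]
  simp only [Fin.not_lt, Fin.last_le_iff]
  rfl

theorem sum_class_eq_sum_card {m : ℕ} (hm : ∀ x, π x < m) (j : Fin (e + 1)) :
    ∑ x with φ x = j, p ^ π x =
      ∑ s ∈ Finset.range m, (Finset.univ.filter fun x => (π x, φ x) = (s, j)).card * p ^ s := by
  rw [← Finset.sum_fiberwise_of_maps_to (t := Finset.range m) (g := π)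
    fun x _ => Finset.mem_range.2 (hm x)]
  refine Finset.sum_congr rfl fun s _ => ?_
  rw [Finset.filter_filter, Finset.sum_congr rfl (g := fun _ => p ^ s), Finset.sum_const,
    smul_eq_mul]
  · congr 2
    ext x
    simp [and_comm]
  · intro x hx
    rw [(Finset.mem_filter.1 hx).2.2]

theorem exists_perm_of_card_eq
    (h : ∀ c, (Finset.univ.filter fun x => (π x, φ x) = c).card =
      (Finset.univ.filter fun x => (π x, φ' x) = c).card) :
    ∃ g : Equiv.Perm I, π ∘ g = π ∧ φ' ∘ g = φ := by
  have hc : ∀ c, Nonempty ({x // (π x, φ x) = c} ≃ {x // (π x, φ' x) = c}) := fun c => by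
    refine Fintype.card_eq.1 ?_
    rw [Fintype.card_subtype, Fintype.card_subtype]
    exact h c
  refine ⟨Equiv.ofFiberEquiv fun c => (hc c).some, funext fun x => ?_, funext fun x => ?_⟩
  · exact congrArg Prod.fst (Equiv.ofFiberEquiv_map (fun c => (hc c).some) x)
  · exact congrArg Prod.snd (Equiv.ofFiberEquiv_map (fun c => (hc c).some) x)

theorem IsMinimalAssignment.exists_perm [NeZero n] (hp : 2 ≤ p)
    (hπ : ∀ t, (Finset.univ.filter fun x => π x = t).card ≤ p - 1)
    (hφ : IsMinimalAssignment p n π φ) (hφ' : IsMinimalAssignment p n π φ') :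
    ∃ g : Equiv.Perm I, π ∘ g = π ∧ φ' ∘ g = φ := by
  have hW := hφ.partialWeight_eq_partialWeight hp hπ hφ'
  have hclass : ∀ j, ∑ x with φ x = j, p ^ π x = ∑ x with φ' x = j, p ^ π x := fun j => by
    induction j using Fin.lastCases with
    | last =>
      have h1 := partialWeight_last_add (p := p) (π := π) (φ := φ)
      have h2 := partialWeight_last_add (p := p) (π := π) (φ := φ')
      rw [← h2, hW] at h1
      exact Nat.add_left_cancel h1
    | cast j =>
      have h1 := partialWeight_succ (p := p) (π := π) (φ := φ) j
      rw [hW, hW, partialWeight_succ] at h1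
      exact (Nat.add_left_cancel h1).symm
  obtain ⟨m, hm⟩ : ∃ m, ∀ x, π x < m :=
    ⟨Finset.univ.sup π + 1, fun x => Nat.lt_succ_of_le (Finset.le_sup (Finset.mem_univ x))⟩
  have hlt : ∀ (ψ : I → Fin (e + 1)) (j : Fin (e + 1)) (s : ℕ),
      (Finset.univ.filter fun x => (π x, ψ x) = (s, j)).card < p := fun ψ j s => by
    refine lt_of_le_of_lt ((Finset.card_le_card fun x => ?_).trans (hπ s)) (by omega)
    simp +contextual
  refine exists_perm_of_card_eq fun c => ?_
  obtain ⟨s, j⟩ := c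
  by_cases hs : s < m
  · have h1 := hclass j
    rw [sum_class_eq_sum_card hm, sum_class_eq_sum_card hm] at h1
    exact eq_of_sum_mul_pow_eq (hlt φ j) (hlt φ' j) h1 s hs
  · have h0 : ∀ ψ : I → Fin (e + 1),
        (Finset.univ.filter fun x => (π x, ψ x) = (s, j)) = ∅ := fun ψ => by
      refine Finset.filter_eq_empty_iff.2 fun x _ hx => hs ?_
      obtain rfl : π x = s := (Prod.ext_iff.1 hx).1
      exact hm x
    rw [h0, h0]

theorem sum_filter_comp_perm {g : Equiv.Perm I} (hg : π ∘ g = π) (P : Fin (e + 1) → Prop)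
    [DecidablePred P] : ∑ x with P ((φ ∘ g) x), p ^ π x = ∑ x with P (φ x), p ^ π x := by
  rw [Finset.sum_filter, Finset.sum_filter,
    ← Equiv.sum_comp g fun x => if P (φ x) then p ^ π x else 0]
  refine Finset.sum_congr rfl fun x _ => ?_
  rw [show π (g x) = π x from congrFun hg x]
  rfl

theorem IsMinimalAssignment.comp_perm (hφ : IsMinimalAssignment p n π φ) {g : Equiv.Perm I}
    (hg : π ∘ g = π) : IsMinimalAssignment p n π (φ ∘ g) where
  valid j := by
    rw [sum_filter_comp_perm hg fun y => y = j.castSucc]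
    exact hφ.valid j
  le φ' hφ' := by
    refine le_trans (Finset.sum_le_sum fun j _ => ?_) (hφ.le φ' hφ')
    exact (sum_filter_comp_perm hg fun y => y < j).le

theorem IsMinimalAssignment.not_dvd_card [NeZero n] (hp : p.Prime)
    (hπ : ∀ t, (Finset.univ.filter fun x => π x = t).card ≤ p - 1)
    (hφ : IsMinimalAssignment p n π φ) :
    ¬ p ∣ Nat.card {φ' : I → Fin (e + 1) // IsMinimalAssignment p n π φ'} := by
  classical
  let G := MulAction.stabilizer (Equiv.Perm I)ᵈᵐᵃ π
  have horbit : {φ' : I → Fin (e + 1) | IsMinimalAssignment p n π φ'} = MulAction.orbit G φ := by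
    ext φ'
    constructor
    · intro hφ'
      obtain ⟨g, hg, rfl⟩ := hφ'.exists_perm hp.two_le hπ hφ
      exact ⟨⟨DomMulAct.mk g, DomMulAct.mem_stabilizer_iff.2 hg⟩, rfl⟩
    · rintro ⟨g, rfl⟩
      exact hφ.comp_perm (DomMulAct.mem_stabilizer_iff.1 g.2)
  have hcard : Nat.card G =
      ∏ t ∈ Finset.univ.image π, (Fintype.card {x // π x = t}).factorial := by
    rw [← DomMulAct.stabilizer_card' π, ← Nat.card_eq_fintype_card]
    exact Nat.card_congr ((DomMulAct.mk.symm).subtypeEquiv fun g => DomMulAct.mem_stabilizer_iff)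
  intro hdvd
  have h1 : p ∣ Nat.card G := by
    have h2 := Nat.card_congr (MulAction.orbitProdStabilizerEquivGroup G φ)
    rw [Nat.card_prod] at h2
    rw [← h2]
    refine Dvd.dvd.mul_right ?_ _
    rw [← horbit]
    exact hdvd
  rw [hcard, hp.prime.dvd_finsetProd_iff] at h1
  obtain ⟨t, -, ht⟩ := h1
  rw [hp.dvd_factorial, Fintype.card_subtype] at ht
  have := hπ t
  have := hp.two_le
  omega

end

theorem FiniteField.sum_pow_eq_ite (F : Type*) [Field F] [Fintype F] (r : ℕ) :
    ∑ y : F, y ^ r = if 0 < r ∧ (Fintype.card F - 1) ∣ r then -1 else 0 := by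
  classical
  rcases Nat.eq_zero_or_pos r with rfl | hr
  · simp
  rw [← Finset.sum_erase_add _ _ (Finset.mem_univ (0 : F)), zero_pow hr.ne', add_zero]
  have h1 : ∑ y ∈ Finset.univ.erase (0 : F), y ^ r = ∑ y : Fˣ, (y : F) ^ r := by
    refine (Finset.sum_bij' (fun (y : Fˣ) _ => (y : F))
      (fun y hy => Units.mk0 y (Finset.ne_of_mem_erase hy))
      ?_ ?_ ?_ ?_ ?_).symm <;> simp
  rw [h1, FiniteField.sum_pow_units]
  simp [hr]

theorem sum_C_mul_X_pow_pow_eq {F : Type*} [Field F] {I : Type*} [Fintype I] [DecidableEq I]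
    {e : ℕ} (p : ℕ) [Fact p.Prime] [CharP F p] (π : I → ℕ) (b : Fin (e + 1) → F) :
    (∑ j, C (b j) * X ^ (j : ℕ)) ^ (∑ x, p ^ π x) =
      ∑ φ : I → Fin (e + 1),
        C (∏ x, b (φ x) ^ p ^ π x) * X ^ (∑ x, (φ x : ℕ) * p ^ π x) := by
  rw [← Finset.prod_pow_eq_pow_sum]
  simp only [sum_pow_char_pow]
  rw [Finset.prod_univ_sum, Fintype.piFinset_univ]
  refine Finset.sum_congr rfl fun φ _ => ?_
  simp only [mul_pow, Finset.prod_mul_distrib, map_prod, map_pow, ← pow_mul,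
    Finset.prod_pow_eq_pow_sum]

section

variable {F : Type*} [Field F] [Fintype F] {I : Type*} [Fintype I] {e p n : ℕ} {π : I → ℕ}

theorem sum_monic_eq_sum_coeff {M : Finset F[X]}
    (hM : ∀ f : F[X], f ∈ M ↔ f.Monic ∧ f.natDegree = e) {R : Type*} [AddCommMonoid R]
    (G : F[X] → R) :
    ∑ f ∈ M, G f =
      ∑ a : Fin e → F, G (∑ j, C (Fin.snoc (α := fun _ => F) a 1 j) * X ^ (j : ℕ)) := by
  have hcoeff : ∀ (b : Fin (e + 1) → F) (j : Fin (e + 1)),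
      (∑ i, C (b i) * X ^ (i : ℕ)).coeff (j : ℕ) = b j := fun b j => by
    simp [coeff_C_mul, coeff_X_pow, Fin.val_inj]
  have hdeg : ∀ b : Fin (e + 1) → F, (∑ i, C (b i) * X ^ (i : ℕ)).natDegree ≤ e := fun b =>
    natDegree_sum_le_of_forall_le _ _ fun j _ =>
      (natDegree_C_mul_X_pow_le _ _).trans (Nat.lt_succ_iff.1 j.2)
  have hmonic : ∀ a : Fin e → F,
      (∑ j, C (Fin.snoc (α := fun _ => F) a 1 j) * X ^ (j : ℕ)).coeff e = 1 := fun a => by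
    have := hcoeff (Fin.snoc (α := fun _ => F) a 1) (Fin.last e)
    rwa [Fin.snoc_last, Fin.val_last] at this
  refine Finset.sum_bij' (fun f _ j => f.coeff j)
    (fun a _ => ∑ j, C (Fin.snoc (α := fun _ => F) a 1 j) * X ^ (j : ℕ))
    (fun _ _ => Finset.mem_univ _) ?_ ?_ ?_ ?_
  · intro a _
    exact (hM _).2 ⟨monic_of_natDegree_le_of_coeff_eq_one e (hdeg _) (hmonic a),
      natDegree_eq_of_le_of_coeff_ne_zero (hdeg _) (by rw [hmonic]; exact one_ne_zero)⟩
  · intro f hf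
    obtain ⟨h1, rfl⟩ := (hM f).1 hf
    conv_rhs => rw [f.as_sum_range_C_mul_X_pow, ← Fin.sum_univ_eq_sum_range
      (fun j => C (f.coeff j) * X ^ j)]
    simp [Fin.sum_univ_castSucc, h1.leadingCoeff]
  · intro a _
    funext j
    have := hcoeff (Fin.snoc (α := fun _ => F) a 1) j.castSucc
    rwa [Fin.snoc_castSucc, Fin.val_castSucc] at this
  · intro f hf
    obtain ⟨h1, rfl⟩ := (hM f).1 hf
    congr 1
    conv_lhs => rw [f.as_sum_range_C_mul_X_pow, ← Fin.sum_univ_eq_sum_range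
      (fun j => C (f.coeff j) * X ^ j)]
    simp [Fin.sum_univ_castSucc, h1.leadingCoeff]

theorem sum_prod_snoc_pow (hF : Fintype.card F = p ^ n) (φ : I → Fin (e + 1))
    [Decidable (IsValidAssignment p n π φ)] :
    ∑ a : Fin e → F, ∏ x, (Fin.snoc (α := fun _ => F) a 1 (φ x) : F) ^ p ^ π x =
      if IsValidAssignment p n π φ then (-1) ^ e else 0 := by
  have h1 : ∀ a : Fin e → F, ∏ x, (Fin.snoc (α := fun _ => F) a 1 (φ x) : F) ^ p ^ π x =
      ∏ j : Fin e, a j ^ ∑ x with φ x = j.castSucc, p ^ π x := fun a => by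
    rw [← Finset.prod_fiberwise (s := Finset.univ) (g := φ), Fin.prod_univ_castSucc]
    have h2 : ∀ j, ∏ x with φ x = j, (Fin.snoc (α := fun _ => F) a 1 (φ x) : F) ^ p ^ π x =
        (Fin.snoc (α := fun _ => F) a 1 j : F) ^ ∑ x with φ x = j, p ^ π x := fun j => by
      rw [← Finset.prod_pow_eq_pow_sum]
      refine Finset.prod_congr rfl fun x hx => ?_
      rw [(Finset.mem_filter.1 hx).2]
    simp only [h2, Fin.snoc_last, Fin.snoc_castSucc, one_pow, mul_one]
  simp only [h1]
  rw [← Fintype.piFinset_univ,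
    ← Finset.prod_univ_sum (fun _ => Finset.univ)
      (fun (j : Fin e) (y : F) => y ^ ∑ x with φ x = j.castSucc, p ^ π x)]
  simp only [FiniteField.sum_pow_eq_ite, hF]
  split_ifs with h
  · rw [Finset.prod_congr rfl fun j _ => if_pos (h j)]
    simp
  · obtain ⟨j, hj⟩ := not_forall.1 h
    exact Finset.prod_eq_zero (Finset.mem_univ j) (if_neg hj)

theorem sum_monic_pow_eq [Fact p.Prime] [CharP F p] (hF : Fintype.card F = p ^ n)
    {M : Finset F[X]} (hM : ∀ f : F[X], f ∈ M ↔ f.Monic ∧ f.natDegree = e) (π : I → ℕ)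
    [DecidableEq I] [DecidablePred fun φ : I → Fin (e + 1) => IsValidAssignment p n π φ] :
    ∑ f ∈ M, f ^ (∑ x, p ^ π x) =
      ∑ φ : I → Fin (e + 1) with IsValidAssignment p n π φ,
        C ((-1) ^ e) * X ^ (∑ x, (φ x : ℕ) * p ^ π x) := by
  rw [sum_monic_eq_sum_coeff hM]
  simp only [sum_C_mul_X_pow_pow_eq p π]
  rw [Finset.sum_comm, Finset.sum_filter]
  refine Finset.sum_congr rfl fun φ _ => ?_
  rw [← Finset.sum_mul, ← map_sum, sum_prod_snoc_pow hF]
  split_ifs <;> simp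

theorem sum_partialWeight_add (φ : I → Fin (e + 1)) :
    ∑ j, partialWeight p π φ j + ∑ x, (φ x : ℕ) * p ^ π x = e * ∑ x, p ^ π x := by
  have h1 : ∑ j, partialWeight p π φ j = ∑ x, (e - (φ x : ℕ)) * p ^ π x := by
    simp only [partialWeight, Finset.sum_filter]
    rw [Finset.sum_comm]
    refine Finset.sum_congr rfl fun x _ => ?_
    rw [← Finset.sum_filter, Finset.sum_const, smul_eq_mul, Finset.filter_lt_eq_Ioi, Fin.card_Ioi]
    congr 1
  rw [h1, ← Finset.sum_add_distrib, Finset.mul_sum]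
  refine Finset.sum_congr rfl fun x _ => ?_
  rw [← add_mul, Nat.sub_add_cancel (Nat.lt_succ_iff.1 (φ x).2)]

theorem sum_monic_pow_ne_zero_iff (hp : p.Prime) (hn : 0 < n) (hF : Fintype.card F = p ^ n)
    {M : Finset F[X]} (hM : ∀ f : F[X], f ∈ M ↔ f.Monic ∧ f.natDegree = e)
    (hπ : ∀ t, (Finset.univ.filter fun x => π x = t).card ≤ p - 1) :
    ∑ f ∈ M, f ^ (∑ x, p ^ π x) ≠ 0 ↔ ∃ φ : I → Fin (e + 1), IsValidAssignment p n π φ := by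
  classical
  have : Fact p.Prime := ⟨hp⟩
  have : NeZero n := ⟨hn.ne'⟩
  have : CharP F p := charP_of_card_eq_prime_pow (hF)
  rw [sum_monic_pow_eq hF hM]
  constructor
  · intro h
    obtain ⟨φ, hφ, -⟩ := Finset.exists_ne_zero_of_sum_ne_zero h
    exact ⟨φ, (Finset.mem_filter.1 hφ).2⟩
  · rintro ⟨φ₀, hφ₀⟩ h
    obtain ⟨φ, hφ, hmin⟩ := Finset.exists_min_image
      (Finset.univ.filter fun φ : I → Fin (e + 1) => IsValidAssignment p n π φ)
      (fun φ => ∑ j, partialWeight p π φ j) ⟨φ₀, by simpa using hφ₀⟩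
    have hφm : IsMinimalAssignment p n π φ := ⟨(Finset.mem_filter.1 hφ).2, fun φ' hφ' =>
      hmin φ' (Finset.mem_filter.2 ⟨Finset.mem_univ _, hφ'⟩)⟩
    refine hφm.not_dvd_card hp hπ ?_
    have hfilter : ∀ φ' : I → Fin (e + 1), IsMinimalAssignment p n π φ' ↔
        IsValidAssignment p n π φ' ∧
          ∑ x, (φ x : ℕ) * p ^ π x = ∑ x, (φ' x : ℕ) * p ^ π x := fun φ' => by
      have h1 := sum_partialWeight_add (p := p) (π := π) φ
      have h2 := sum_partialWeight_add (p := p) (π := π) φ'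
      constructor
      · intro hφ'
        have h3 := hφ'.le φ hφm.valid
        have h4 := hφm.le φ' hφ'.valid
        exact ⟨hφ'.valid, by omega⟩
      · rintro ⟨hv, hd⟩
        refine ⟨hv, fun ψ hψ => ?_⟩
        have h4 := hφm.le ψ hψ
        omega
    have h1 := congrArg (coeff · (∑ x, (φ x : ℕ) * p ^ π x)) h
    simp only [finsetSum_coeff, coeff_C_mul, coeff_X_pow, coeff_zero, ← Finset.mul_sum,
      Finset.sum_boole, Finset.filter_filter, ← hfilter] at h1
    rw [← CharP.cast_eq_zero_iff F p, Nat.card_eq_fintype_card, Fintype.card_subtype]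
    exact (mul_eq_zero.1 h1).resolve_left (pow_ne_zero _ (neg_ne_zero.2 one_ne_zero))

end

theorem sum_range_div_pow_mod_mul_pow (b m N : ℕ) :
    ∑ i ∈ Finset.range N, m / b ^ i % b * b ^ i = m % b ^ N := by
  induction N with
  | zero => simp [Nat.mod_one]
  | succ N ih => rw [Finset.sum_range_succ, ih, Nat.mod_pow_succ, mul_comm (b ^ N)]

theorem rhoStar_refl {q : ℕ} (hq : 1 < q) (k : ℕ) : rhoStar q (Equiv.refl ℕ) k = k := by
  have h := sum_range_div_pow_mod_mul_pow q k (k + 1)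
  rw [Nat.mod_eq_of_lt ((Nat.lt_succ_self k).trans (Nat.lt_pow_self hq))] at h
  exact h

/-- The units of the base `p` digits of the base `p ^ n` digits of `k`: the triple `⟨i, b, c⟩` is
the `c`-th unit of the `b`-th base `p` digit of the `i`-th base `p ^ n` digit. -/
abbrev DigitUnit (p n k : ℕ) : Type :=
  Σ (i : Fin (k + 1)) (b : Fin n), Fin (k / (p ^ n) ^ (i : ℕ) % p ^ n / p ^ (b : ℕ) % p)

namespace DigitUnit

variable {p n k : ℕ}

/-- The exponent of `p` attached to a unit once the base `p ^ n` digits have been moved by `σ`. -/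
def exponent (σ : Equiv.Perm ℕ) (x : DigitUnit p n k) : ℕ := n * σ x.1 + x.2.1

theorem sum_pow_exponent (hp : 0 < p) (σ : Equiv.Perm ℕ) :
    ∑ x : DigitUnit p n k, p ^ exponent σ x = rhoStar (p ^ n) σ k := by
  simp only [Fintype.sum_sigma, exponent, Finset.sum_const, Finset.card_univ, Fintype.card_fin,
    smul_eq_mul]
  rw [rhoStar, ← Fin.sum_univ_eq_sum_range
    (fun i => k / (p ^ n) ^ i % p ^ n * (p ^ n) ^ σ i)]
  refine Finset.sum_congr rfl fun i _ => ?_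
  set c := k / (p ^ n) ^ (i : ℕ) % p ^ n
  have hc : ∑ b : Fin n, c / p ^ (b : ℕ) % p * p ^ (b : ℕ) = c := by
    rw [Fin.sum_univ_eq_sum_range (fun b => c / p ^ b % p * p ^ b), sum_range_div_pow_mod_mul_pow]
    exact Nat.mod_eq_of_lt (Nat.mod_lt _ (by positivity))
  conv_rhs => rw [← hc, Finset.sum_mul]
  refine Finset.sum_congr rfl fun b _ => ?_
  rw [pow_add, pow_mul, mul_assoc, mul_comm ((p ^ n) ^ σ i)]

theorem card_exponent_eq_le (hp : 0 < p) (σ : Equiv.Perm ℕ) (t : ℕ) :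
    (Finset.univ.filter fun x : DigitUnit p n k => exponent σ x = t).card ≤ p - 1 := by
  rw [← Finset.card_range (p - 1)]
  refine Finset.card_le_card_of_injOn (fun x => (x.2.2 : ℕ)) ?_ ?_
  · intro x _
    have h1 := x.2.2.2
    have h2 := Nat.mod_lt (k / (p ^ n) ^ (x.1 : ℕ) % p ^ n / p ^ (x.2.1 : ℕ)) hp
    simp only [Finset.coe_range, Set.mem_Iio]
    omega
  · rintro ⟨i, b, c⟩ hx ⟨i', b', c'⟩ hx' hc
    have h : n * σ i + b = n * σ i' + b' :=
      (Finset.mem_filter.1 hx).2.trans (Finset.mem_filter.1 hx').2.symm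
    have hn : 0 < n := lt_of_le_of_lt (Nat.zero_le _) b.2
    have hb : (b : ℕ) = b' := by
      have := congrArg (· % n) h
      simpa [Nat.mul_add_mod, Nat.mod_eq_of_lt b.2, Nat.mod_eq_of_lt b'.2] using this
    have hi : (i : ℕ) = i' := by
      rw [hb, add_left_inj] at h
      exact σ.injective (Nat.eq_of_mul_eq_mul_left hn h)
    obtain rfl := Fin.ext hi
    obtain rfl := Fin.ext hb
    obtain rfl := Fin.ext hc
    rfl

theorem pow_exponent_modEq (hp : 0 < p) (σ : Equiv.Perm ℕ) (x : DigitUnit p n k) :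
    p ^ exponent σ x ≡ p ^ (x.2.1 : ℕ) [MOD p ^ n - 1] := by
  have h1 : p ^ n ≡ 1 [MOD p ^ n - 1] := by
    refine ((Nat.modEq_iff_dvd' (Nat.one_le_pow _ _ hp)).2 dvd_rfl).symm
  have h2 := (h1.pow (σ x.1)).mul_right (p ^ (x.2.1 : ℕ))
  rwa [one_pow, one_mul, ← pow_mul, ← pow_add] at h2

theorem isValidAssignment_exponent (hp : 0 < p) (σ τ : Equiv.Perm ℕ) {e : ℕ}
    {φ : DigitUnit p n k → Fin (e + 1)} (h : IsValidAssignment p n (exponent σ) φ) :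
    IsValidAssignment p n (exponent τ) φ := by
  intro j
  obtain ⟨h1, h2⟩ := h j
  refine ⟨?_, ?_⟩
  · obtain ⟨x, hx, -⟩ := Finset.exists_ne_zero_of_sum_ne_zero h1.ne'
    exact Finset.sum_pos (fun _ _ => by positivity) ⟨x, hx⟩
  · have h3 : ∑ x with φ x = j.castSucc, p ^ exponent τ x ≡
        ∑ x with φ x = j.castSucc, p ^ exponent σ x [MOD p ^ n - 1] :=
      Nat.ModEq.sum fun x _ => (pow_exponent_modEq hp τ x).trans (pow_exponent_modEq hp σ x).symm
    exact (h3.dvd_iff dvd_rfl).2 h2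

end DigitUnit

/-- the power sum `S_e(i) = Σ_{f monic, deg f = e} f^i` over `F_q[T]`
vanishes iff `S_e(ρ_*(i))` vanishes.  Here `M e` is the finite set of monic polynomials
of degree `e`. -/
theorem powerSum_eq_zero_iff_rhoStar (p q : ℕ) (hp : p.Prime)
    (hq : ∃ n : ℕ, 0 < n ∧ q = p ^ n)
    (F : Type*) [Field F] [Fintype F] (hF : Fintype.card F = q)
    (M : ℕ → Finset (Polynomial F))
    (hM : ∀ (e : ℕ) (f : Polynomial F), f ∈ M e ↔ f.Monic ∧ f.natDegree = e)
    (ρ : Equiv.Perm ℕ) (e i : ℕ) :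
    (∑ f ∈ M e, f ^ i = 0) ↔ (∑ f ∈ M e, f ^ rhoStar q ρ i = 0) := by
  obtain ⟨n, hn, rfl⟩ := hq
  have key : ∀ σ : Equiv.Perm ℕ, ∑ f ∈ M e, f ^ rhoStar (p ^ n) σ i ≠ 0 ↔
      ∃ φ : DigitUnit p n i → Fin (e + 1), IsValidAssignment p n (DigitUnit.exponent σ) φ :=
    fun σ => by
      rw [← DigitUnit.sum_pow_exponent hp.pos σ]
      exact sum_monic_pow_ne_zero_iff hp hn hF (hM e) (DigitUnit.card_exponent_eq_le hp.pos σ)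
  have h := key (Equiv.refl ℕ)
  rw [rhoStar_refl (Nat.one_lt_pow hn.ne' hp.one_lt)] at h
  rw [← not_iff_not]
  refine h.trans (Iff.trans ?_ (key ρ).symm)
  exact exists_congr fun φ => ⟨DigitUnit.isValidAssignment_exponent hp.pos _ _,
    DigitUnit.isValidAssignment_exponent hp.pos _ _⟩
end
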